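/- Fix a real number k and a real s_L. There exist constants C > 0 and N₀ ∈ ℕ such that for all N ≥ N₀ and all s ≥ s_L: |(2N)^{1/4} τ_N φ_N(u_N + τ_N(s + k Δ_N)) − Ai(s) − k Δ_N Ai'(s)| ≤ C N^{−2/3} e^{−s/2}, and likewise |(2N)^{1/4} τ_N² φ_N'(u_N + τ_N(s + k Δ_N)) − Ai'(s) − k Δ_N Ai''(s)| ≤ C N^{−2/3} e^{−s/2}. -/

import Mathlib

open Real Filter MeasureTheory

/-- Physicists' Hermite polynomial `H_n(x) = (-1)^n e^{x²} (d^n/dx^n) e^{-x²}`. -/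
noncomputable def physHermite (n : ℕ) (x : ℝ) : ℝ :=
  (-1 : ℝ) ^ n * Real.exp (x ^ 2) * iteratedDeriv n (fun t : ℝ => Real.exp (-t ^ 2)) x

/-- Normalizing constant `h_n = √π 2^n n!`. -/
noncomputable def hNorm (n : ℕ) : ℝ := Real.sqrt Real.pi * 2 ^ n * (n.factorial : ℝ)

/-- Oscillator wave function `φ_n(x) = h_n^{-1/2} e^{-x²/2} H_n(x)`. -/
noncomputable def osc (n : ℕ) (x : ℝ) : ℝ :=
  hNorm n ^ (-(1 : ℝ) / 2) * Real.exp (-x ^ 2 / 2) * physHermite n x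

/-- Airy function `Ai(x) = π⁻¹ lim_{R→∞} ∫₀^R cos(t³/3 + xt) dt`. -/
noncomputable def Ai (x : ℝ) : ℝ :=
  Real.pi⁻¹ *
    limUnder Filter.atTop (fun R : ℝ => ∫ t in (0 : ℝ)..R, Real.cos (t ^ 3 / 3 + x * t))

/-- Scaling constant `τ_N = 2^{-1/2} N^{-1/6}`. -/
noncomputable def tauN (N : ℕ) : ℝ := (2 : ℝ) ^ (-(1 : ℝ) / 2) * (N : ℝ) ^ (-(1 : ℝ) / 6)

/-- `Δ_N = (√(2N+1) - √(2N-1))/τ_N`. -/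
noncomputable def DeltaN (N : ℕ) : ℝ :=
  (Real.sqrt (2 * N + 1) - Real.sqrt (2 * N - 1)) / tauN N

/-! ### The Hermite recurrence and the oscillator equation -/

/-- The Gaussian `exp (-t ^ 2)`, whose derivatives generate the Hermite polynomials. -/
noncomputable def gauss (t : ℝ) : ℝ := Real.exp (-t ^ 2)

lemma contDiff_gauss : ContDiff ℝ ⊤ gauss := by
  unfold gauss; fun_prop

lemma hasDerivAt_iteratedDeriv_gauss (n : ℕ) (x : ℝ) :
    HasDerivAt (iteratedDeriv n gauss) (iteratedDeriv (n + 1) gauss x) x := by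
  rw [iteratedDeriv_succ]
  have : Differentiable ℝ (iteratedDeriv n gauss) :=
    contDiff_gauss.differentiable_iteratedDeriv n (WithTop.coe_lt_top _)
  exact (this x).hasDerivAt

lemma hasDerivAt_gauss (x : ℝ) : HasDerivAt gauss (-2 * x * gauss x) x := by
  unfold gauss
  convert! ((hasDerivAt_pow 2 x).neg).exp using 1
  simp; ring

lemma iteratedDeriv_one_gauss (x : ℝ) : iteratedDeriv 1 gauss x = -2 * x * gauss x := by
  rw [iteratedDeriv_one]; exact (hasDerivAt_gauss x).deriv

lemma iteratedDeriv_gauss_add_two (n : ℕ) (x : ℝ) :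
    iteratedDeriv (n + 2) gauss x =
      -2 * x * iteratedDeriv (n + 1) gauss x - 2 * (n + 1) * iteratedDeriv n gauss x := by
  induction n generalizing x with
  | zero =>
    have h : iteratedDeriv 1 gauss = fun y => -2 * y * gauss y :=
      funext iteratedDeriv_one_gauss
    have h1 : HasDerivAt (iteratedDeriv 1 gauss)
        (-2 * gauss x + -2 * x * (-2 * x * gauss x)) x := by
      rw [h]
      exact (by simpa using (hasDerivAt_id x).const_mul (-2 : ℝ) :
        HasDerivAt (fun y : ℝ => -2 * y) (-2) x).mul (hasDerivAt_gauss x)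
    rw [(hasDerivAt_iteratedDeriv_gauss 1 x).unique h1, zero_add, iteratedDeriv_one_gauss]
    simp; ring
  | succ n ih =>
    have h1 : HasDerivAt (iteratedDeriv (n + 2) gauss)
        (-2 * iteratedDeriv (n + 1) gauss x + -2 * x * iteratedDeriv (n + 2) gauss x
          - 2 * (n + 1) * iteratedDeriv (n + 1) gauss x) x := by
      refine HasDerivAt.congr_of_eventuallyEq ?_ (Eventually.of_forall ih)
      exact ((by simpa using (hasDerivAt_id x).const_mul (-2 : ℝ) :
        HasDerivAt (fun y : ℝ => -2 * y) (-2) x).mul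
          (hasDerivAt_iteratedDeriv_gauss (n + 1) x)).sub
        ((hasDerivAt_iteratedDeriv_gauss n x).const_mul _)
    rw [(hasDerivAt_iteratedDeriv_gauss (n + 2) x).unique h1]
    push_cast; ring

lemma physHermite_eq (n : ℕ) (x : ℝ) :
    physHermite n x = (-1) ^ n * Real.exp (x ^ 2) * iteratedDeriv n gauss x := rfl

lemma physHermite_zero (x : ℝ) : physHermite 0 x = 1 := by
  simp [physHermite_eq, gauss, ← Real.exp_add]

lemma physHermite_one (x : ℝ) : physHermite 1 x = 2 * x := by
  rw [physHermite_eq, iteratedDeriv_one_gauss, gauss]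
  have : Real.exp (x ^ 2) * Real.exp (-x ^ 2) = 1 := by rw [← Real.exp_add]; simp
  linear_combination (2 * x) * this

lemma physHermite_add_two (n : ℕ) (x : ℝ) :
    physHermite (n + 2) x = 2 * x * physHermite (n + 1) x - 2 * (n + 1) * physHermite n x := by
  simp only [physHermite_eq, iteratedDeriv_gauss_add_two]
  ring

lemma osc_eq (n : ℕ) (x : ℝ) :
    osc n x = hNorm n ^ (-(1 : ℝ) / 2) * (-1) ^ n *
      (Real.exp (x ^ 2 / 2) * iteratedDeriv n gauss x) := by
  have : Real.exp (x ^ 2 / 2) = Real.exp (-x ^ 2 / 2) * Real.exp (x ^ 2) := by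
    rw [← Real.exp_add]; ring_nf
  rw [osc, physHermite_eq, this]; ring

lemma hasDerivAt_exp_half_sq (x : ℝ) :
    HasDerivAt (fun y : ℝ => Real.exp (y ^ 2 / 2)) (x * Real.exp (x ^ 2 / 2)) x := by
  convert! ((hasDerivAt_pow 2 x).div_const 2).exp using 1
  simp; ring

lemma hasDerivAt_osc (n : ℕ) (x : ℝ) :
    HasDerivAt (osc n) (x * osc n x + hNorm n ^ (-(1 : ℝ) / 2) * (-1) ^ n *
      (Real.exp (x ^ 2 / 2) * iteratedDeriv (n + 1) gauss x)) x := by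
  have h := (((hasDerivAt_exp_half_sq x).mul (hasDerivAt_iteratedDeriv_gauss n x)).const_mul
    (hNorm n ^ (-(1 : ℝ) / 2) * (-1) ^ n))
  refine HasDerivAt.congr_of_eventuallyEq ?_ (Eventually.of_forall (osc_eq n))
  convert! h using 1
  rw [osc_eq]; ring

lemma differentiable_osc (n : ℕ) : Differentiable ℝ (osc n) :=
  fun x => (hasDerivAt_osc n x).differentiableAt

/-- The harmonic oscillator equation `φ_n'' = (x² - (2n+1)) φ_n`. -/
lemma hasDerivAt_deriv_osc (n : ℕ) (x : ℝ) :
    HasDerivAt (deriv (osc n)) ((x ^ 2 - (2 * n + 1)) * osc n x) x := by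
  rw [funext fun y => (hasDerivAt_osc n y).deriv]
  have h := ((hasDerivAt_id x).mul (hasDerivAt_osc n x)).add
    (((hasDerivAt_exp_half_sq x).mul (hasDerivAt_iteratedDeriv_gauss (n + 1) x)).const_mul
      (hNorm n ^ (-(1 : ℝ) / 2) * (-1) ^ n))
  convert! h using 1
  rw [iteratedDeriv_gauss_add_two]
  simp only [osc_eq, id]
  ring

/-! ### A contour integral for the Hermite polynomials -/

/-- The Laguerre generating function `(1 - w)^(-P) exp (-X w / (1 - w))`. -/
noncomputable def lagGen (P X : ℝ) (w : ℂ) : ℂ :=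
  Complex.exp (-P * Complex.log (1 - w)) * Complex.exp (-X * w / (1 - w))

/-- `2π` times the `m`-th Taylor coefficient of `lagGen P X`, as an integral over a circle. -/
noncomputable def lagCoeff (P X r : ℝ) (m : ℕ) : ℂ :=
  ∫ t in (0 : ℝ)..2 * π, (circleMap 0 r t)⁻¹ ^ m * lagGen P X (circleMap 0 r t)

lemma one_sub_mem_slitPlane {w : ℂ} (hw : ‖w‖ < 1) : 1 - w ∈ Complex.slitPlane := by
  refine Or.inl ?_
  have := (Complex.abs_re_le_norm w).trans_lt hw
  rw [Complex.sub_re, Complex.one_re]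
  linarith [(abs_lt.1 this).2]

lemma hasDerivAt_lagGen (P X : ℝ) {w : ℂ} (hw : ‖w‖ < 1) :
    HasDerivAt (lagGen P X) (lagGen P X w * (P / (1 - w) - X / (1 - w) ^ 2)) w := by
  have h0 : 1 - w ≠ 0 := Complex.slitPlane_ne_zero (one_sub_mem_slitPlane hw)
  have h1 : HasDerivAt (fun w : ℂ => 1 - w) (-1) w := by
    simpa using (hasDerivAt_id w).const_sub 1
  have h2 := ((h1.clog (one_sub_mem_slitPlane hw)).const_mul (-P : ℂ)).cexp
  have h3 := ((((hasDerivAt_id w).const_mul (-X : ℂ))).div h1 h0).cexp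
  convert! h2.mul h3 using 1
  simp only [lagGen, id, Pi.div_apply]
  field_simp
  ring

lemma lagGen_add_one (P X : ℝ) {w : ℂ} (hw : ‖w‖ < 1) :
    lagGen (P + 1) X w * (1 - w) = lagGen P X w := by
  have h0 : 1 - w ≠ 0 := Complex.slitPlane_ne_zero (one_sub_mem_slitPlane hw)
  have : Complex.exp (-(P + 1 : ℝ) * Complex.log (1 - w)) * (1 - w) =
      Complex.exp (-P * Complex.log (1 - w)) := by
    nth_rw 2 [← Complex.exp_log h0]
    rw [← Complex.exp_add]
    congr 1; push_cast; ring
  rw [lagGen, lagGen, ← this]; ring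

section circle

variable {r : ℝ}

lemma norm_circleMap_lt_one (hr : 0 < r) (hr1 : r < 1) (t : ℝ) : ‖circleMap 0 r t‖ < 1 := by
  rw [norm_circleMap_zero, abs_of_pos hr]; exact hr1

lemma continuous_lagGen_circleMap (P X : ℝ) (hr : 0 < r) (hr1 : r < 1) :
    Continuous fun t => lagGen P X (circleMap 0 r t) := by
  refine continuous_iff_continuousAt.2 fun t => ?_
  exact ContinuousAt.comp (f := circleMap 0 r) (g := lagGen P X)
    (hasDerivAt_lagGen P X (norm_circleMap_lt_one hr hr1 t)).continuousAt
    (continuous_circleMap 0 r).continuousAt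

lemma continuous_inv_circleMap (hr : 0 < r) : Continuous fun t => (circleMap 0 r t)⁻¹ :=
  (continuous_circleMap 0 r).inv₀ fun _ => circleMap_ne_center hr.ne'

lemma intervalIntegrable_lagCoeff (P X : ℝ) (hr : 0 < r) (hr1 : r < 1) (m : ℕ) (a b : ℝ) :
    IntervalIntegrable (fun t => (circleMap 0 r t)⁻¹ ^ m * lagGen P X (circleMap 0 r t))
      volume a b :=
  (((continuous_inv_circleMap hr).pow m).mul
    (continuous_lagGen_circleMap P X hr hr1)).intervalIntegrable a b

lemma lagCoeff_zero (P X : ℝ) (hr : 0 < r) (hr1 : r < 1) : lagCoeff P X r 0 = 2 * π := by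
  have h : DiffContOnCl ℂ (lagGen P X) (Metric.ball 0 |r|) := by
    refine DifferentiableOn.diffContOnCl fun w hw => ?_
    refine (hasDerivAt_lagGen P X ?_).differentiableAt.differentiableWithinAt
    have := Metric.closure_ball_subset_closedBall hw
    rw [mem_closedBall_zero_iff, abs_of_pos hr] at this
    linarith
  have h1 := h.circleAverage
  rw [Real.circleAverage_def, inv_smul_eq_iff₀ (by positivity)] at h1
  simp only [lagCoeff, pow_zero, one_mul]
  rw [h1]
  simp [lagGen]

lemma lagCoeff_add_one_succ (P X : ℝ) (hr : 0 < r) (hr1 : r < 1) (m : ℕ) :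
    lagCoeff (P + 1) X r (m + 1) - lagCoeff (P + 1) X r m = lagCoeff P X r (m + 1) := by
  rw [lagCoeff, lagCoeff, ← intervalIntegral.integral_sub
    (intervalIntegrable_lagCoeff _ _ hr hr1 _ _ _) (intervalIntegrable_lagCoeff _ _ hr hr1 _ _ _)]
  refine intervalIntegral.integral_congr fun t _ => ?_
  have h0 : circleMap 0 r t ≠ 0 := circleMap_ne_center hr.ne'
  rw [← lagGen_add_one P X (norm_circleMap_lt_one hr hr1 t), pow_succ]
  field_simp

lemma lagCoeff_succ (P X : ℝ) (hr : 0 < r) (hr1 : r < 1) (m : ℕ) :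
    (m + 1) * lagCoeff P X r (m + 1) =
      (m + P) * lagCoeff P X r m - X * lagCoeff (P + 1) X r m := by
  set w := circleMap 0 r with hw
  have hd : ∀ t, HasDerivAt
      (fun t => (w t)⁻¹ ^ (m + 1) * lagGen P X (w t) - (w t)⁻¹ ^ m * lagGen P X (w t))
      (Complex.I * ((m + P) * ((w t)⁻¹ ^ m * lagGen P X (w t))
        - X * ((w t)⁻¹ ^ m * lagGen (P + 1) X (w t))
        - (m + 1) * ((w t)⁻¹ ^ (m + 1) * lagGen P X (w t)))) t := by
    intro t
    have hw1 := norm_circleMap_lt_one hr hr1 t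
    have h0 : w t ≠ 0 := circleMap_ne_center hr.ne'
    have h1 : 1 - w t ≠ 0 := Complex.slitPlane_ne_zero (one_sub_mem_slitPlane hw1)
    have hw' : HasDerivAt w (w t * Complex.I) t := hasDerivAt_circleMap 0 r t
    have hG := (hasDerivAt_lagGen P X hw1).comp t hw'
    have hi := hw'.inv h0
    have := ((hi.pow (m + 1)).mul hG).sub ((hi.pow m).mul hG)
    convert! this using 1
    rw [← hw, ← lagGen_add_one P X hw1]
    have hp : (m : ℂ) * (w t)⁻¹ ^ (m - 1) = m * ((w t)⁻¹ ^ m * w t) := by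
      rcases m with _ | m
      · simp
      · rw [Nat.add_sub_cancel, pow_succ]; field_simp
    simp only [Function.comp, Pi.pow_apply, Pi.inv_apply, Nat.add_sub_cancel, hp, pow_succ]
    rw [← lagGen_add_one P X hw1]
    push_cast
    field_simp
    ring
  have hc := fun (P : ℝ) (m : ℕ) => intervalIntegrable_lagCoeff P X hr hr1 m 0 (2 * π)
  have hint := intervalIntegral.integral_eq_sub_of_hasDerivAt (a := 0) (b := 2 * π)
    (fun t _ => hd t)
    (((((hc P m).const_mul _).sub ((hc (P + 1) m).const_mul _)).sub
      ((hc P (m + 1)).const_mul _)).const_mul _)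
  have hper : w (2 * π) = w 0 := by
    simpa using periodic_circleMap 0 r 0
  rw [hper, sub_self, intervalIntegral.integral_const_mul, intervalIntegral.integral_sub
    (((hc P m).const_mul _).sub ((hc (P + 1) m).const_mul _)) ((hc P (m + 1)).const_mul _),
    intervalIntegral.integral_sub ((hc P m).const_mul _) ((hc (P + 1) m).const_mul _),
    intervalIntegral.integral_const_mul, intervalIntegral.integral_const_mul,
    intervalIntegral.integral_const_mul] at hint
  have := (mul_eq_zero.1 hint).resolve_left Complex.I_ne_zero
  simp only [lagCoeff]
  linear_combination -this

/-- Even and odd Hermite polynomials as Taylor coefficients of Laguerre generating functions. -/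
lemma physHermite_eq_lagCoeff (hr : 0 < r) (hr1 : r < 1) (x : ℝ) (m : ℕ) :
    (2 * π * physHermite (2 * m) x : ℂ) =
        (-4) ^ m * m.factorial * lagCoeff (1 / 2) (x ^ 2) r m ∧
      (2 * π * physHermite (2 * m + 1) x : ℂ) =
        2 * x * ((-4) ^ m * m.factorial) * lagCoeff (1 / 2 + 1) (x ^ 2) r m := by
  induction m with
  | zero =>
    simp only [mul_zero, zero_add, physHermite_zero, physHermite_one, lagCoeff_zero _ _ hr hr1]
    simp; ring
  | succ m ih =>
    obtain ⟨h0, h1⟩ := ih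
    have hA := lagCoeff_succ (1 / 2) (x ^ 2) hr hr1 m
    have hB := lagCoeff_add_one_succ (1 / 2) (x ^ 2) hr hr1 m
    have e2 : (2 * π * physHermite (2 * (m + 1)) x : ℂ) =
        (-4) ^ (m + 1) * (m + 1).factorial * lagCoeff (1 / 2) (x ^ 2) r (m + 1) := by
      have := physHermite_add_two (2 * m) x
      rw [show 2 * (m + 1) = 2 * m + 2 by ring, this, Nat.factorial_succ]
      push_cast at hA ⊢
      linear_combination (2 * x : ℂ) * h1 - 2 * (2 * m + 1) * h0
        + (4 * (-4) ^ m * m.factorial) * hA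
    refine ⟨e2, ?_⟩
    have := physHermite_add_two (2 * m + 1) x
    rw [show 2 * (m + 1) + 1 = 2 * m + 1 + 2 by ring, this]
    rw [show 2 * m + 1 + 1 = 2 * (m + 1) by ring]
    rw [Nat.factorial_succ] at e2 ⊢
    push_cast at e2 ⊢
    linear_combination (2 * x : ℂ) * e2 - 2 * (2 * m + 2) * h1
      - (2 * x * (-4) ^ (m + 1) * ((m + 1) * m.factorial)) * hB

end circle

/-! ### The Airy function as an integral over a vertical line -/

/-- Parametrization of the vertical line `Re ζ = 1`. -/
noncomputable def vline (y : ℝ) : ℂ := 1 + y * Complex.I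

/-- The Airy integrand `exp (ζ³/3 - s ζ)` on the line `Re ζ = 1`. -/
noncomputable def airyKer (s y : ℝ) : ℂ := Complex.exp (vline y ^ 3 / 3 - s * vline y)

/-- The `j`-th derivative of `2π Ai`, as an integral over the line `Re ζ = 1`. -/
noncomputable def airyInt (j : ℕ) (s : ℝ) : ℂ := ∫ y : ℝ, (-vline y) ^ j * airyKer s y

lemma continuous_vline : Continuous vline := by unfold vline; fun_prop

lemma continuous_airyKer (s : ℝ) : Continuous (airyKer s) := by
  unfold airyKer
  have := continuous_vline
  fun_prop

lemma norm_vline_le (y : ℝ) : ‖vline y‖ ≤ 1 + |y| := by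
  unfold vline
  refine (norm_add_le _ _).trans ?_
  simp

lemma norm_airyKer (s y : ℝ) : ‖airyKer s y‖ = Real.exp (1 / 3 - y ^ 2 - s) := by
  rw [airyKer, Complex.norm_exp]
  congr 1
  have h : vline y ^ 3 / 3 - s * vline y =
      ((1 / 3 - y ^ 2 - s : ℝ) : ℂ) + ((y - y ^ 3 / 3 - s * y : ℝ) : ℂ) * Complex.I := by
    unfold vline
    push_cast
    linear_combination (y ^ 2 : ℂ) * Complex.I_sq + (y ^ 3 * Complex.I / 3 : ℂ) * Complex.I_sq
  rw [h, Complex.add_re, Complex.re_ofReal_mul, Complex.I_re, Complex.ofReal_re, mul_zero, add_zero]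

lemma one_add_abs_pow_le (n : ℕ) (y : ℝ) :
    (1 + |y|) ^ n ≤ n.factorial * Real.exp 21 * Real.exp (y ^ 2 / 80) := by
  have h := Real.pow_div_factorial_le_exp (1 + |y|) (by positivity) n
  rw [div_le_iff₀ (by positivity)] at h
  have h2 : Real.exp (1 + |y|) ≤ Real.exp 21 * Real.exp (y ^ 2 / 80) := by
    rw [← Real.exp_add]
    refine Real.exp_le_exp.2 ?_
    nlinarith [sq_nonneg (|y| - 40), sq_abs y]
  calc (1 + |y|) ^ n ≤ Real.exp (1 + |y|) * n.factorial := h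
    _ ≤ (Real.exp 21 * Real.exp (y ^ 2 / 80)) * n.factorial := by gcongr
    _ = _ := by ring

lemma norm_pow_mul_airyKer_le (j : ℕ) (s y : ℝ) :
    ‖(-vline y) ^ j * airyKer s y‖ ≤
      j.factorial * Real.exp 22 * Real.exp (-s) * Real.exp (-(1 / 80) * y ^ 2) := by
  rw [norm_mul, norm_pow, norm_neg, norm_airyKer]
  have h1 : ‖vline y‖ ^ j ≤ j.factorial * Real.exp 21 * Real.exp (y ^ 2 / 80) :=
    (pow_le_pow_left₀ (norm_nonneg _) (norm_vline_le y) j).trans (one_add_abs_pow_le j y)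
  calc ‖vline y‖ ^ j * Real.exp (1 / 3 - y ^ 2 - s)
      ≤ (j.factorial * Real.exp 21 * Real.exp (y ^ 2 / 80)) * Real.exp (1 / 3 - y ^ 2 - s) := by
        gcongr
    _ = j.factorial * Real.exp (21 + y ^ 2 / 80 + (1 / 3 - y ^ 2 - s)) := by
        rw [Real.exp_add, Real.exp_add]; ring
    _ ≤ j.factorial * Real.exp (22 + -s + -(1 / 80) * y ^ 2) := by
        refine mul_le_mul_of_nonneg_left (Real.exp_le_exp.2 ?_) (Nat.cast_nonneg _)
        nlinarith [sq_nonneg y]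
    _ = _ := by rw [Real.exp_add, Real.exp_add]; ring

lemma integrable_gaussian_bound (C : ℝ) :
    Integrable fun y : ℝ => C * Real.exp (-(1 / 80) * y ^ 2) :=
  (integrable_exp_neg_mul_sq (by norm_num)).const_mul C

lemma continuous_pow_mul_airyKer (j : ℕ) (s : ℝ) :
    Continuous fun y => (-vline y) ^ j * airyKer s y :=
  (continuous_vline.neg.pow j).mul (continuous_airyKer s)

lemma integrable_pow_mul_airyKer (j : ℕ) (s : ℝ) :
    Integrable fun y => (-vline y) ^ j * airyKer s y :=
  (integrable_gaussian_bound _).mono' (continuous_pow_mul_airyKer j s).aestronglyMeasurable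
    (Eventually.of_forall (norm_pow_mul_airyKer_le j s))

lemma norm_airyInt_le (j : ℕ) : ∃ C > 0, ∀ s, ‖airyInt j s‖ ≤ C * Real.exp (-s) := by
  refine ⟨j.factorial * Real.exp 22 * ∫ y : ℝ, Real.exp (-(1 / 80) * y ^ 2), ?_, fun s => ?_⟩
  · rw [integral_gaussian]; positivity
  · refine (norm_integral_le_of_norm_le (integrable_gaussian_bound _)
      (Eventually.of_forall (norm_pow_mul_airyKer_le j s))).trans_eq ?_
    rw [integral_const_mul]; ring

lemma hasDerivAt_airyInt (j : ℕ) (s : ℝ) :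
    HasDerivAt (airyInt j) (airyInt (j + 1) s) s := by
  refine (hasDerivAt_integral_of_dominated_loc_of_deriv_le (μ := volume)
    (F := fun s y => (-vline y) ^ j * airyKer s y)
    (F' := fun s y => (-vline y) ^ (j + 1) * airyKer s y)
    (bound := fun y => ((j + 1).factorial * Real.exp 22 * Real.exp (1 - s))
      * Real.exp (-(1 / 80) * y ^ 2))
    (Metric.ball_mem_nhds s one_pos)
    (Eventually.of_forall fun s => (continuous_pow_mul_airyKer j s).aestronglyMeasurable)
    (integrable_pow_mul_airyKer j s)
    (continuous_pow_mul_airyKer (j + 1) s).aestronglyMeasurable ?_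
    (integrable_gaussian_bound _) ?_).2
  · refine Eventually.of_forall fun y u hu => (norm_pow_mul_airyKer_le (j + 1) u y).trans ?_
    have := (abs_lt.1 (Real.dist_eq u s ▸ Metric.mem_ball.1 hu)).1
    gcongr
    linarith
  · refine Eventually.of_forall fun y u _ => ?_
    have h1 : HasDerivAt (fun u : ℝ => vline y ^ 3 / 3 - (u : ℂ) * vline y) (-vline y) u := by
      simpa using ((Complex.ofRealCLM.hasDerivAt (x := u)).mul_const (vline y)).const_sub
        (vline y ^ 3 / 3)
    convert! h1.cexp.const_mul ((-vline y) ^ j) using 1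
    rw [airyKer, pow_succ]; ring

lemma airyInt_two (s : ℝ) : airyInt 2 s = s * airyInt 0 s := by
  have hd : ∀ y : ℝ, HasDerivAt (airyKer s)
      (Complex.I * ((-vline y) ^ 2 * airyKer s y - s * ((-vline y) ^ 0 * airyKer s y))) y := by
    intro y
    have hv : HasDerivAt vline Complex.I y := by
      convert! ((Complex.ofRealCLM.hasDerivAt (x := y)).mul_const Complex.I).const_add 1 using 1
      simp
    convert! (((hv.pow 3).div_const 3).sub (hv.const_mul (s : ℂ))).cexp using 1
    simp only [airyKer, Pi.pow_apply, Pi.sub_apply]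
    push_cast; ring
  have h0 := integrable_pow_mul_airyKer 0 s
  have h2 := integrable_pow_mul_airyKer 2 s
  have := integral_eq_zero_of_hasDerivAt_of_integrable hd
    ((h2.sub (h0.const_mul _)).const_mul _) (by simpa using h0)
  rw [integral_const_mul, integral_sub h2 (h0.const_mul _), integral_const_mul] at this
  exact sub_eq_zero.1 ((mul_eq_zero.1 this).resolve_left Complex.I_ne_zero)

lemma integral_exp_neg_mul_le {R : ℝ} (hR : 0 < R) :
    ∫ t in (0 : ℝ)..1, Real.exp (-(R ^ 2 * t)) ≤ 1 / R ^ 2 := by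
  have hd : ∀ t : ℝ, HasDerivAt (fun t => -(Real.exp (-(R ^ 2 * t)) / R ^ 2))
      (Real.exp (-(R ^ 2 * t))) t := by
    intro t
    have h1 : HasDerivAt (fun t : ℝ => -(R ^ 2 * t)) (-R ^ 2) t := by
      simpa using! ((hasDerivAt_id t).const_mul (R ^ 2)).neg
    convert! (h1.exp.div_const (R ^ 2)).neg using 1
    field_simp
  rw [intervalIntegral.integral_eq_sub_of_hasDerivAt (fun t _ => hd t)
    (Continuous.intervalIntegrable (by fun_prop) _ _)]
  have : 0 < Real.exp (-(R ^ 2 * 1)) / R ^ 2 := by positivity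
  simp at this ⊢
  linarith

/-- The horizontal sides of the rectangle used to shift the Airy contour are negligible. -/
lemma norm_airy_side_le (s : ℝ) {R y : ℝ} (hR : 0 < R) (hy : y ^ 2 = R ^ 2) :
    ‖∫ t in (0 : ℝ)..1, Complex.exp ((t + y * Complex.I) ^ 3 / 3 - s * (t + y * Complex.I))‖ ≤
      Real.exp (1 + |s|) * (1 / R ^ 2) := by
  have hn : ∀ t ∈ Set.Ioc (0 : ℝ) 1,
      ‖Complex.exp ((t + y * Complex.I) ^ 3 / 3 - s * (t + y * Complex.I))‖ ≤
        Real.exp (1 + |s|) * Real.exp (-(R ^ 2 * t)) := by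
    intro t ht
    rw [Complex.norm_exp, ← Real.exp_add]
    refine Real.exp_le_exp.2 ?_
    have h : (t + y * Complex.I) ^ 3 / 3 - s * (t + y * Complex.I) =
      ((t ^ 3 / 3 - t * y ^ 2 - s * t : ℝ) : ℂ) +
        ((t ^ 2 * y - y ^ 3 / 3 - s * y : ℝ) : ℂ) * Complex.I := by
      push_cast
      linear_combination
        (t * y ^ 2 : ℂ) * Complex.I_sq + (y ^ 3 * Complex.I / 3 : ℂ) * Complex.I_sq
    rw [h, Complex.add_re, Complex.re_ofReal_mul, Complex.I_re, Complex.ofReal_re, mul_zero,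
      add_zero, hy]
    have h1 : -s * t ≤ |s| := by
      have := neg_abs_le s
      have := abs_nonneg s
      nlinarith [ht.1, ht.2]
    have h2 : t ^ 3 ≤ 1 := pow_le_one₀ ht.1.le ht.2
    nlinarith
  refine (intervalIntegral.norm_integral_le_of_norm_le zero_le_one
    (Eventually.of_forall hn) (Continuous.intervalIntegrable (by fun_prop) _ _)).trans ?_
  rw [intervalIntegral.integral_const_mul]
  gcongr
  exact integral_exp_neg_mul_le hR

lemma tendsto_airy_cos (s : ℝ) :
    Tendsto (fun R : ℝ => ∫ t in (0 : ℝ)..R, Real.cos (t ^ 3 / 3 + s * t)) atTop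
      (nhds ((airyInt 0 s).re / 2)) := by
  set f : ℂ → ℂ := fun z => Complex.exp (z ^ 3 / 3 - s * z) with hf
  have hfd : Differentiable ℂ f := by rw [hf]; fun_prop
  have hfc : Continuous f := hfd.continuous
  have hrect : ∀ R : ℝ, 2 * ∫ t in (0 : ℝ)..R, Real.cos (t ^ 3 / 3 + s * t) =
      (∫ y in (-R)..R, airyKer s y).re -
        (Complex.I * ((∫ t in (0 : ℝ)..1, f (t + (-R : ℝ) * Complex.I)) -
          ∫ t in (0 : ℝ)..1, f (t + R * Complex.I))).re := by
    intro R
    have h := Complex.integral_boundary_rect_eq_zero_of_differentiableOn f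
      ((-R : ℝ) * Complex.I) (1 + R * Complex.I) hfd.differentiableOn
    simp only [Complex.re_ofReal_mul, Complex.I_re, mul_zero, Complex.add_re, Complex.one_re,
      Complex.im_ofReal_mul, Complex.I_im, mul_one, Complex.add_im, Complex.one_im, zero_add,
      add_zero, smul_eq_mul, Complex.ofReal_zero, Complex.ofReal_one] at h
    have hcos : (∫ y in (-R)..R, f (y * Complex.I)).re =
        2 * ∫ t in (0 : ℝ)..R, Real.cos (t ^ 3 / 3 + s * t) := by
      have hre : ∀ y : ℝ, (f (y * Complex.I)).re = Real.cos (y ^ 3 / 3 + s * y) := by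
        intro y
        have : (y * Complex.I) ^ 3 / 3 - s * (y * Complex.I) =
            ((-(y ^ 3 / 3 + s * y) : ℝ) : ℂ) * Complex.I := by
          push_cast
          linear_combination (y ^ 3 * Complex.I / 3 : ℂ) * Complex.I_sq
        rw [hf]
        simp only
        rw [this, Complex.exp_ofReal_mul_I_re, Real.cos_neg]
      have hi : ∀ a b, IntervalIntegrable (fun y : ℝ => Real.cos (y ^ 3 / 3 + s * y))
          volume a b := fun a b => Continuous.intervalIntegrable (by fun_prop) _ _
      have h1 : (∫ y in (-R)..R, f (y * Complex.I)).re =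
          ∫ y in (-R)..R, Real.cos (y ^ 3 / 3 + s * y) := by
        have := Complex.reCLM.intervalIntegral_comp_comm (a := -R) (b := R) (μ := volume)
          (f := fun y : ℝ => f (y * Complex.I))
          (Continuous.intervalIntegrable (by fun_prop) _ _)
        simp only [Complex.reCLM_apply, hre] at this
        exact this.symm
      have h2 : ∫ y in (-R)..0, Real.cos (y ^ 3 / 3 + s * y) =
          ∫ y in (0 : ℝ)..R, Real.cos (y ^ 3 / 3 + s * y) := by
        have := intervalIntegral.integral_comp_neg (a := 0) (b := R)
          (fun y : ℝ => Real.cos (y ^ 3 / 3 + s * y))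
        rw [neg_zero] at this
        rw [← this]
        refine intervalIntegral.integral_congr fun y _ => ?_
        rw [← Real.cos_neg]
        congr 1; ring
      rw [h1, ← intervalIntegral.integral_add_adjacent_intervals (hi (-R) 0) (hi 0 R), h2]
      ring
    rw [← hcos]
    have hk : (∫ y in (-R)..R, airyKer s y) = ∫ y in (-R)..R, f (1 + y * Complex.I) := rfl
    rw [hk]
    have e : (∫ y in (-R)..R, f (y * Complex.I)) =
        (∫ y in (-R)..R, f (1 + y * Complex.I)) -
        (Complex.I * ((∫ t in (0 : ℝ)..1, f (t + (-R : ℝ) * Complex.I)) -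
          ∫ t in (0 : ℝ)..1, f (t + R * Complex.I))) := by
      linear_combination Complex.I * h + ((∫ y in (-R)..R, f (y * Complex.I)) -
        ∫ y in (-R)..R, f (1 + y * Complex.I)) * Complex.I_sq
    rw [e, Complex.sub_re]
  have hI : Tendsto (fun R : ℝ => (∫ y in (-R)..R, airyKer s y).re) atTop
      (nhds (airyInt 0 s).re) := by
    refine (Complex.continuous_re.tendsto _).comp ?_
    have := intervalIntegral_tendsto_integral (integrable_pow_mul_airyKer 0 s)
      tendsto_neg_atTop_atBot tendsto_id
    simpa [airyInt] using this
  have hside : Tendsto (fun R : ℝ =>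
      (Complex.I * ((∫ t in (0 : ℝ)..1, f (t + (-R : ℝ) * Complex.I)) -
          ∫ t in (0 : ℝ)..1, f (t + R * Complex.I))).re) atTop (nhds 0) := by
    have hb : Tendsto (fun R : ℝ => 2 * Real.exp (1 + |s|) * (R ^ 2)⁻¹) atTop (nhds 0) := by
      simpa using (tendsto_inv_atTop_zero.comp (tendsto_pow_atTop (α := ℝ)
        (two_ne_zero))).const_mul (2 * Real.exp (1 + |s|))
    refine squeeze_zero_norm' ?_ hb
    filter_upwards [eventually_gt_atTop 0] with R hR
    have h1 := norm_airy_side_le s hR (y := -R) (by ring)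
    have h2 := norm_airy_side_le s hR (y := R) rfl
    refine (Complex.abs_re_le_norm _).trans ?_
    rw [norm_mul, Complex.norm_I, one_mul]
    refine (norm_sub_le _ _).trans ((add_le_add h1 h2).trans_eq ?_)
    field_simp; ring
  have := (hI.sub hside).div_const 2
  rw [sub_zero] at this
  refine this.congr fun R => ?_
  rw [← hrect R]; ring

lemma Ai_eq (s : ℝ) : Ai s = (2 * π)⁻¹ * (airyInt 0 s).re := by
  rw [Ai, (tendsto_airy_cos s).limUnder_eq]
  field_simp

lemma hasDerivAt_re_airyInt (j : ℕ) (s : ℝ) :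
    HasDerivAt (fun s => (2 * π)⁻¹ * (airyInt j s).re) ((2 * π)⁻¹ * (airyInt (j + 1) s).re) s :=
  (Complex.reCLM.hasFDerivAt.comp_hasDerivAt s (hasDerivAt_airyInt j s)).const_mul _

lemma deriv_Ai (s : ℝ) : deriv Ai s = (2 * π)⁻¹ * (airyInt 1 s).re := by
  rw [funext Ai_eq]
  exact (hasDerivAt_re_airyInt 0 s).deriv

lemma hasDerivAt_Ai (s : ℝ) : HasDerivAt Ai (deriv Ai s) s := by
  rw [deriv_Ai, funext Ai_eq]
  exact hasDerivAt_re_airyInt 0 s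

/-- The Airy equation. -/
lemma hasDerivAt_deriv_Ai (s : ℝ) : HasDerivAt (deriv Ai) (s * Ai s) s := by
  rw [funext deriv_Ai, Ai_eq]
  convert! hasDerivAt_re_airyInt 1 s using 1
  rw [airyInt_two, Complex.re_ofReal_mul]
  ring

lemma abs_re_airyInt_le (j : ℕ) :
    ∃ C > 0, ∀ s, |(2 * π)⁻¹ * (airyInt j s).re| ≤ C * Real.exp (-s) := by
  obtain ⟨C, hC, h⟩ := norm_airyInt_le j
  refine ⟨(2 * π)⁻¹ * C, by positivity, fun s => ?_⟩
  rw [abs_mul, abs_of_pos (by positivity : 0 < (2 * π)⁻¹), mul_assoc]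
  gcongr
  exact (Complex.abs_re_le_norm _).trans (h s)

lemma abs_Ai_le : ∃ C > 0, ∀ s, |Ai s| ≤ C * Real.exp (-s) := by
  simpa only [Ai_eq] using abs_re_airyInt_le 0

lemma abs_deriv_Ai_le : ∃ C > 0, ∀ s, |deriv Ai s| ≤ C * Real.exp (-s) := by
  simpa only [deriv_Ai] using abs_re_airyInt_le 1

/-! ### The rescaled Hermite kernel and its comparison with the Airy kernel -/

open Asymptotics Topology in
lemma isBigO_pow_succ_of_hasDerivAt {f f' : ℂ → ℂ} {n : ℕ} (h0 : f 0 = 0)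
    (hd : ∀ᶠ z in 𝓝 0, HasDerivAt f (f' z) z) (hf' : f' =O[𝓝 0] fun z => z ^ n) :
    f =O[𝓝 0] fun z => z ^ (n + 1) := by
  obtain ⟨C, hC⟩ := hf'.bound
  obtain ⟨ε, hε, hb⟩ := Metric.eventually_nhds_iff_ball.1 (hd.and hC)
  refine IsBigO.of_bound C ?_
  filter_upwards [Metric.ball_mem_nhds (0 : ℂ) hε] with z hz
  have hC0 : 0 ≤ C * ‖z‖ ^ n := by
    have := (norm_nonneg _).trans (hb z hz).2
    rwa [norm_pow] at this
  rw [mem_ball_zero_iff] at hz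
  have hmem : ∀ w ∈ Metric.closedBall (0 : ℂ) ‖z‖, w ∈ Metric.ball (0 : ℂ) ε := by
    intro w hw
    rw [mem_closedBall_zero_iff] at hw
    exact mem_ball_zero_iff.2 (hw.trans_lt hz)
  have hbd : ∀ w ∈ Metric.closedBall (0 : ℂ) ‖z‖, ‖f' w‖ ≤ C * ‖z‖ ^ n := by
    intro w hw
    have h := (hb w (hmem w hw)).2
    rw [norm_pow] at h
    rw [mem_closedBall_zero_iff] at hw
    rcases eq_or_ne z 0 with rfl | hz0
    · have : w = 0 := by simpa using hw
      rwa [this] at h ⊢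
    · have hzp : 0 < ‖z‖ ^ n := by positivity
      have hCn : 0 ≤ C := nonneg_of_mul_nonneg_left hC0 hzp
      exact h.trans (by gcongr)
  have := (convex_closedBall (0 : ℂ) ‖z‖).norm_image_sub_le_of_norm_hasDerivWithin_le
    (fun w hw => (hb w (hmem w hw)).1.hasDerivWithinAt) hbd
    (Metric.mem_closedBall_self (norm_nonneg z)) (mem_closedBall_zero_iff.2 le_rfl)
  rw [h0, sub_zero, sub_zero] at this
  rw [norm_pow, pow_succ]
  linarith

/-- The hyperbolic tangent, written through `exp (-2 θ)`. -/
noncomputable def expTanh (θ : ℂ) : ℂ := (1 - Complex.exp (-2 * θ)) / (1 + Complex.exp (-2 * θ))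

/-- The logarithm of `cosh θ`, written through `exp (-2 θ)`. -/
noncomputable def logCosh (θ : ℂ) : ℂ := Complex.log ((1 + Complex.exp (-2 * θ)) / 2) + θ

lemma hasDerivAt_exp_neg_two_mul (θ : ℂ) :
    HasDerivAt (fun θ : ℂ => Complex.exp (-2 * θ)) (-2 * Complex.exp (-2 * θ)) θ := by
  convert! ((hasDerivAt_id θ).const_mul (-2 : ℂ)).cexp using 1
  simp; ring

lemma hasDerivAt_expTanh {θ : ℂ} (h : 1 + Complex.exp (-2 * θ) ≠ 0) :
    HasDerivAt expTanh (1 - expTanh θ ^ 2) θ := by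
  have h1 := hasDerivAt_exp_neg_two_mul θ
  convert! (h1.const_sub 1).div (h1.const_add 1) h using 1
  rw [expTanh]
  generalize Complex.exp (-2 * θ) = q at h ⊢
  field_simp
  ring

lemma hasDerivAt_logCosh {θ : ℂ} (h : (1 + Complex.exp (-2 * θ)) / 2 ∈ Complex.slitPlane) :
    HasDerivAt logCosh (expTanh θ) θ := by
  have h1 := hasDerivAt_exp_neg_two_mul θ
  have h0 : 1 + Complex.exp (-2 * θ) ≠ 0 := fun h' => by rw [h'] at h; simp at h
  convert! (((h1.const_add 1).div_const 2).clog h).add (hasDerivAt_id θ) using 1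
  rw [expTanh]
  generalize Complex.exp (-2 * θ) = q at h0 ⊢
  field_simp
  ring

lemma expTanh_zero : expTanh 0 = 0 := by simp [expTanh]

lemma logCosh_zero : logCosh 0 = 0 := by norm_num [logCosh]

open Asymptotics Topology in
lemma expTanh_isBigO :
    (expTanh =O[𝓝 0] fun z => z ^ 1) ∧
    ((fun z => expTanh z - z) =O[𝓝 0] fun z => z ^ 3) ∧
    ((fun z => expTanh z - z + z ^ 3 / 3) =O[𝓝 0] fun z => z ^ 5) := by
  have hd : ∀ᶠ z in 𝓝 (0 : ℂ), HasDerivAt expTanh (1 - expTanh z ^ 2) z := by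
    have hc : ContinuousAt (fun θ : ℂ => 1 + Complex.exp (-2 * θ)) 0 := by fun_prop
    have hne : (1 + Complex.exp (-2 * 0) : ℂ) ≠ 0 := by norm_num
    filter_upwards [hc.eventually_ne hne] with z hz
    exact hasDerivAt_expTanh hz
  have h1 : expTanh =O[𝓝 0] fun z => z ^ 1 := by
    have := hd.self_of_nhds.isBigO_sub
    simpa [expTanh_zero] using this
  have h3 : (fun z => expTanh z - z) =O[𝓝 0] fun z => z ^ 3 := by
    refine isBigO_pow_succ_of_hasDerivAt (f' := fun z => -(expTanh z ^ 2))
      (by simp [expTanh_zero]) ?_ ?_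
    · filter_upwards [hd] with z hz
      convert! hz.sub (hasDerivAt_id z) using 1
      ring
    · simpa using (h1.pow 2).neg_left
  refine ⟨h1, h3, isBigO_pow_succ_of_hasDerivAt
    (f' := fun z => -((expTanh z - z) * (expTanh z + z))) (by simp [expTanh_zero]) ?_ ?_⟩
  · filter_upwards [hd] with z hz
    convert! (hz.sub (hasDerivAt_id z)).add (((hasDerivAt_id z).pow 3).div_const 3) using 1
    simp only [id]
    push_cast; ring
  · have h2 : (fun z => expTanh z + z) =O[𝓝 0] fun z => z ^ 1 :=
      h1.add (by simpa using isBigO_refl _ _)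
    refine ((h3.mul h2).neg_left).congr_right fun z => by ring

open Asymptotics Topology in
lemma exp_logCosh_isBigO (P : ℝ) :
    (fun z => Complex.exp (-P * logCosh z) - 1) =O[𝓝 0] fun z => z ^ 2 := by
  have hd : ∀ᶠ z in 𝓝 (0 : ℂ), HasDerivAt logCosh (expTanh z) z := by
    have hc : ContinuousAt (fun θ : ℂ => (1 + Complex.exp (-2 * θ)) / 2) 0 := by fun_prop
    have : ∀ᶠ z in 𝓝 (0 : ℂ), (1 + Complex.exp (-2 * z)) / 2 ∈ Complex.slitPlane :=
      hc.eventually_mem (Complex.isOpen_slitPlane.mem_nhds (by norm_num))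
    filter_upwards [this] with z hz
    exact hasDerivAt_logCosh hz
  refine isBigO_pow_succ_of_hasDerivAt
    (f' := fun z => Complex.exp (-P * logCosh z) * (-P * expTanh z))
    (by simp [logCosh_zero]) ?_ ?_
  · filter_upwards [hd] with z hz
    exact ((hz.const_mul (-P : ℂ)).cexp).sub_const 1
  · have hc : ContinuousAt (fun z => Complex.exp (-P * logCosh z)) 0 :=
      (hd.self_of_nhds.continuousAt.const_mul (-P : ℂ)).cexp
    have := (hc.isBigO_one ℂ).mul (expTanh_isBigO.1.const_mul_left (-P : ℂ))
    simpa using this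

/-- Uniform Taylor bounds near the origin. -/
lemma exists_taylor_bounds (P : ℝ) : ∃ δ > 0, ∃ C > 0, ∀ z : ℂ, ‖z‖ ≤ δ →
    ‖expTanh z - z‖ ≤ C * ‖z‖ ^ 3 ∧ ‖expTanh z - z + z ^ 3 / 3‖ ≤ C * ‖z‖ ^ 5 ∧
    ‖Complex.exp (-P * logCosh z) - 1‖ ≤ C * ‖z‖ ^ 2 := by
  obtain ⟨C1, hC1⟩ := expTanh_isBigO.2.1.bound
  obtain ⟨C2, hC2⟩ := expTanh_isBigO.2.2.bound
  obtain ⟨C3, hC3⟩ := (exp_logCosh_isBigO P).bound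
  obtain ⟨ε, hε, hb⟩ := Metric.eventually_nhds_iff_ball.1 (hC1.and (hC2.and hC3))
  have m1 : C1 ≤ |C1| + |C2| + |C3| + 1 := by
    linarith [le_abs_self C1, abs_nonneg C2, abs_nonneg C3]
  have m2 : C2 ≤ |C1| + |C2| + |C3| + 1 := by
    linarith [le_abs_self C2, abs_nonneg C1, abs_nonneg C3]
  have m3 : C3 ≤ |C1| + |C2| + |C3| + 1 := by
    linarith [le_abs_self C3, abs_nonneg C2, abs_nonneg C1]
  refine ⟨ε / 2, by positivity, |C1| + |C2| + |C3| + 1, by positivity, fun z hz => ?_⟩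
  obtain ⟨h1, h2, h3⟩ := hb z (mem_ball_zero_iff.2 (by linarith))
  rw [norm_pow] at h1 h2 h3
  exact ⟨h1.trans (by gcongr), h2.trans (by gcongr), h3.trans (by gcongr)⟩

lemma norm_exp_sub_exp_le {X Y : ℂ} {B : ℝ} (hX : ‖Complex.exp X‖ ≤ B)
    (hY : ‖Complex.exp Y‖ ≤ B) : ‖Complex.exp X - Complex.exp Y‖ ≤ B * ‖X - Y‖ := by
  have hB : 0 < B := (norm_pos_iff.2 (Complex.exp_ne_zero X)).trans_le hX
  have hmem : ∀ {Z : ℂ}, ‖Complex.exp Z‖ ≤ B → Z ∈ {z : ℂ | z.re ≤ Real.log B} := by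
    intro Z hZ
    rw [Complex.norm_exp] at hZ
    exact (Real.le_log_iff_exp_le hB).2 hZ
  refine (convex_halfSpace_re_le (Real.log B)).norm_image_sub_le_of_norm_hasDerivWithin_le
    (fun z _ => (Complex.hasDerivAt_exp z).hasDerivWithinAt) (fun z hz => ?_) (hmem hY) (hmem hX)
  rw [Complex.norm_exp]
  exact (Real.le_log_iff_exp_le hB).1 hz

/-- Real part of the hyperbolic tangent. -/
lemma expTanh_re (θ : ℂ) : (expTanh θ).re = (1 - Real.exp (-2 * θ.re) ^ 2) /
    (1 + 2 * Real.exp (-2 * θ.re) * Real.cos (2 * θ.im) + Real.exp (-2 * θ.re) ^ 2) := by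
  set q := Complex.exp (-2 * θ) with hq
  have hre : q.re = Real.exp (-2 * θ.re) * Real.cos (2 * θ.im) := by
    rw [hq, Complex.exp_re]; simp
  have him : q.im = -(Real.exp (-2 * θ.re) * Real.sin (2 * θ.im)) := by
    rw [hq, Complex.exp_im]; simp
  have hsq := Real.sin_sq_add_cos_sq (2 * θ.im)
  rw [expTanh, ← hq, Complex.div_re, ← add_div]
  congr 1
  · simp only [Complex.sub_re, Complex.add_re, Complex.one_re, Complex.sub_im, Complex.add_im,
      Complex.one_im, hre, him]
    linear_combination (-Real.exp (-2 * θ.re) ^ 2) * hsq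
  · simp only [Complex.normSq_apply, Complex.add_re, Complex.one_re, Complex.add_im,
      Complex.one_im, hre, him]
    linear_combination (Real.exp (-2 * θ.re) ^ 2) * hsq

lemma exp_neg_two_mul_bounds {a : ℝ} (ha : 0 < a) (ha4 : a ≤ 1 / 4) :
    1 / 2 ≤ Real.exp (-2 * a) ∧ Real.exp (-2 * a) ≤ 1 - a := by
  constructor
  · linarith [Real.add_one_le_exp (-2 * a)]
  · have h := Real.add_one_le_exp (2 * a)
    have hm : Real.exp (-2 * a) * Real.exp (2 * a) = 1 := by rw [← Real.exp_add]; simp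
    have : Real.exp (-2 * a) * (2 * a + 1) ≤ 1 :=
      (mul_le_mul_of_nonneg_left h (Real.exp_pos _).le).trans_eq hm
    nlinarith

/-- On a vertical line, the real part of `tanh` grows quadratically away from the real axis. -/
lemma expTanh_re_lower {a b : ℝ} (ha : 0 < a) (ha4 : a ≤ 1 / 4) (hb : |b| ≤ π / 2) :
    (expTanh a).re + a * b ^ 2 / 20 ≤ (expTanh (a + b * Complex.I)).re := by
  obtain ⟨h1, h2⟩ := exp_neg_two_mul_bounds ha ha4
  rw [expTanh_re, expTanh_re]
  simp only [Complex.ofReal_re, Complex.ofReal_im, mul_zero, Real.cos_zero, mul_one,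
    Complex.add_re, Complex.add_im, Complex.re_ofReal_mul, Complex.im_ofReal_mul, Complex.I_re,
    Complex.I_im, add_zero, zero_add]
  set ρ := Real.exp (-2 * a)
  have hc : 1 - Real.cos (2 * b) = 2 * Real.sin b ^ 2 := by
    rw [Real.cos_two_mul]; linarith [Real.sin_sq_add_cos_sq b]
  have hs : 2 / π * |b| ≤ |Real.sin b| := Real.mul_abs_le_abs_sin hb
  have hs2 : 2 / 5 * b ^ 2 ≤ Real.sin b ^ 2 := by
    have : (2 / π * |b|) ^ 2 ≤ |Real.sin b| ^ 2 := by gcongr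
    rw [sq_abs, mul_pow, sq_abs] at this
    refine le_trans ?_ this
    gcongr
    rw [div_pow, div_le_div_iff₀ (by norm_num) (by positivity)]
    nlinarith [Real.pi_lt_d2, Real.pi_pos]
  set c := Real.cos (2 * b)
  have hc1 : c ≤ 1 := Real.cos_le_one _
  have hc2 : -1 ≤ c := Real.neg_one_le_cos _
  have hD1 : 0 < 1 + 2 * ρ * c + ρ ^ 2 := by nlinarith [sq_pos_of_pos ha]
  have hD2 : 1 + 2 * ρ * c + ρ ^ 2 ≤ 4 := by nlinarith
  have hD3 : 0 < 1 + 2 * ρ + ρ ^ 2 := by positivity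
  have hD4 : 1 + 2 * ρ + ρ ^ 2 ≤ 4 := by nlinarith
  have key : (1 - ρ ^ 2) / (1 + 2 * ρ * c + ρ ^ 2) - (1 - ρ ^ 2) / (1 + 2 * ρ + ρ ^ 2) =
      (1 - ρ ^ 2) * (2 * ρ * (1 - c)) / ((1 + 2 * ρ * c + ρ ^ 2) * (1 + 2 * ρ + ρ ^ 2)) := by
    rw [div_sub_div _ _ hD1.ne' hD3.ne']
    congr 1
    ring
  have h3 : a * b ^ 2 / 20 ≤
      (1 - ρ ^ 2) * (2 * ρ * (1 - c)) / ((1 + 2 * ρ * c + ρ ^ 2) * (1 + 2 * ρ + ρ ^ 2)) := by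
    rw [le_div_iff₀ (by positivity)]
    have e1 : (1 + 2 * ρ * c + ρ ^ 2) * (1 + 2 * ρ + ρ ^ 2) ≤ 16 := by nlinarith
    have e2 : a ≤ 1 - ρ ^ 2 := by nlinarith
    have e3 : 4 / 5 * b ^ 2 ≤ 2 * ρ * (1 - c) := by nlinarith [sq_nonneg b]
    have e4 : a * (4 / 5 * b ^ 2) ≤ (1 - ρ ^ 2) * (2 * ρ * (1 - c)) :=
      mul_le_mul e2 e3 (by positivity) (ha.le.trans e2)
    have e5 : 0 ≤ a * b ^ 2 / 20 := by positivity
    nlinarith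
  linarith

lemma norm_exp_logCosh_le {P : ℝ} (hP : 0 ≤ P) (hP2 : P ≤ 2) {θ : ℂ} (h0 : 0 < θ.re)
    (h4 : θ.re ≤ 1 / 4) : ‖Complex.exp (-P * logCosh θ)‖ ≤ 4 / θ.re ^ 2 := by
  obtain ⟨h1, h2⟩ := exp_neg_two_mul_bounds h0 h4
  have hn : θ.re / 2 ≤ ‖(1 + Complex.exp (-2 * θ)) / 2‖ := by
    rw [norm_div, Complex.norm_two]
    have h := norm_sub_le (1 + Complex.exp (-2 * θ)) (Complex.exp (-2 * θ))
    have he : ‖Complex.exp (-2 * θ)‖ = Real.exp (-2 * θ.re) := by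
      rw [Complex.norm_exp]; simp
    rw [add_sub_cancel_right, norm_one, he] at h
    linarith
  have hre : Real.log (θ.re / 2) ≤ (logCosh θ).re := by
    rw [logCosh, Complex.add_re, Complex.log_re]
    linarith [Real.log_le_log (by positivity) hn]
  have hlog : Real.log (θ.re / 2) ≤ 0 := Real.log_nonpos (by positivity) (by linarith)
  have hr : (-P * logCosh θ : ℂ).re = -P * (logCosh θ).re := by
    rw [← Complex.ofReal_neg, Complex.re_ofReal_mul]
  rw [Complex.norm_exp, hr]
  calc Real.exp (-P * (logCosh θ).re) ≤ Real.exp (-2 * Real.log (θ.re / 2)) := by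
        refine Real.exp_le_exp.2 ?_
        nlinarith
    _ = 4 / θ.re ^ 2 := by
        rw [show -2 * Real.log (θ.re / 2) = -(Real.log (θ.re / 2) + Real.log (θ.re / 2)) by ring,
          Real.exp_neg, Real.exp_add, Real.exp_log (by positivity)]
        field_simp; norm_num

/-- The kernel of the contour integral for the Hermite functions after rescaling by `M`. -/
noncomputable def hermKer (P M s y : ℝ) : ℂ :=
  Complex.exp (-P * logCosh (vline y / M)) *
    Complex.exp (M ^ 3 * (vline y / M) - (M ^ 3 + M * s) * expTanh (vline y / M))

lemma one_add_abs_pow_le_exp {L : ℝ} (n : ℕ) {s : ℝ} (hs : -L ≤ s) :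
    (1 + |s|) ^ n ≤ n.factorial * 8 ^ n * Real.exp (1 / 8 + |L| / 4) * Real.exp (s / 8) := by
  have h := Real.pow_div_factorial_le_exp ((1 + |s|) / 8) (by positivity) n
  rw [div_le_iff₀ (by positivity), div_pow, div_le_iff₀ (by positivity)] at h
  have habs : |s| ≤ s + 2 * |L| := by
    rcases abs_cases s with h | h <;> linarith [le_abs_self L, abs_nonneg L]
  have h2 : Real.exp ((1 + |s|) / 8) ≤ Real.exp (1 / 8 + |L| / 4) * Real.exp (s / 8) := by
    rw [← Real.exp_add]
    exact Real.exp_le_exp.2 (by linarith)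
  calc (1 + |s|) ^ n ≤ Real.exp ((1 + |s|) / 8) * n.factorial * 8 ^ n := h
    _ ≤ Real.exp (1 / 8 + |L| / 4) * Real.exp (s / 8) * n.factorial * 8 ^ n := by gcongr
    _ = _ := by ring

lemma vline_div_eq (y M : ℝ) : vline y / M = ((1 / M : ℝ) : ℂ) + ((y / M : ℝ) : ℂ) * Complex.I := by
  rw [vline]; push_cast; ring

lemma vline_div_re (y M : ℝ) : (vline y / M).re = 1 / M := by
  rw [vline_div_eq, Complex.add_re, Complex.re_ofReal_mul, Complex.I_re, Complex.ofReal_re,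
    mul_zero, add_zero]

lemma norm_exp_phase_le (L : ℝ) : ∃ K > 0, ∃ M₀ ≥ 4, ∀ M ≥ M₀, ∀ s ≥ -L, ∀ y : ℝ,
    |y| ≤ M * π / 2 →
    ‖Complex.exp (M ^ 3 * (vline y / M) - (M ^ 3 + M * s) * expTanh (vline y / M))‖ ≤
      K * (Real.exp (-y ^ 2 / 40) * Real.exp (-7 / 8 * s)) := by
  obtain ⟨δ, hδ, C, hC, hT⟩ := exists_taylor_bounds 0
  refine ⟨Real.exp (C + |L| / 4), Real.exp_pos _, 4 + 1 / δ + 2 * |L| + 8 * C,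
    by have := abs_nonneg L; have : 0 < 1 / δ := by positivity
       linarith, fun M hM s hs y hy => ?_⟩
  have hL := abs_nonneg L
  have hL' := le_abs_self L
  have hδ' : 0 < 1 / δ := by positivity
  have hM4 : 4 ≤ M := by linarith
  have hM0 : 0 < M := by linarith
  have hMδ : 1 / M ≤ δ := by
    rw [div_le_iff₀ hM0, ← div_le_iff₀' hδ]; linarith
  have hMM : M ≤ M ^ 2 := by nlinarith
  set t := (expTanh ((1 / M : ℝ) : ℂ)).re
  have ht : |t - 1 / M| ≤ C * (1 / M) ^ 3 := by
    have hn : ‖((1 / M : ℝ) : ℂ)‖ = 1 / M := by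
      rw [Complex.norm_real, Real.norm_of_nonneg (by positivity)]
    have h := (hT ((1 / M : ℝ) : ℂ) (hn.trans_le hMδ)).1
    rw [hn] at h
    refine le_trans ?_ h
    have := Complex.abs_re_le_norm (expTanh ((1 / M : ℝ) : ℂ) - ((1 / M : ℝ) : ℂ))
    rwa [Complex.sub_re, Complex.ofReal_re] at this
  have hlow : t + 1 / M * (y / M) ^ 2 / 20 ≤ (expTanh (vline y / M)).re := by
    rw [vline_div_eq]
    refine expTanh_re_lower (by positivity) ?_ ?_
    · exact one_div_le_one_div_of_le (by norm_num) hM4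
    · rw [abs_div, abs_of_pos hM0, div_le_iff₀ hM0]; linarith
  have hmul : M ^ 3 / 2 ≤ M ^ 3 + M * s := by
    have : -(M ^ 2) / 2 ≤ s := by nlinarith
    nlinarith [mul_le_mul_of_nonneg_left this hM0.le]
  have hre : (M ^ 3 * (vline y / M) - (M ^ 3 + M * s) * expTanh (vline y / M) : ℂ).re =
      M ^ 2 - (M ^ 3 + M * s) * (expTanh (vline y / M)).re := by
    have e1 : (M ^ 3 * (vline y / M) - (M ^ 3 + M * s) * expTanh (vline y / M) : ℂ) =
        ((M ^ 3 : ℝ) : ℂ) * (vline y / M) - ((M ^ 3 + M * s : ℝ) : ℂ) * expTanh (vline y / M) := by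
      push_cast; ring
    rw [e1, Complex.sub_re, Complex.re_ofReal_mul, Complex.re_ofReal_mul, vline_div_re]
    congr 1
    field_simp
  rw [Complex.norm_exp, hre, ← Real.exp_add, ← Real.exp_add]
  refine Real.exp_le_exp.2 ?_
  have hMt : |M * t - 1| ≤ C / M ^ 2 := by
    have : M * t - 1 = M * (t - 1 / M) := by field_simp
    rw [this, abs_mul, abs_of_pos hM0]
    calc M * |t - 1 / M| ≤ M * (C * (1 / M) ^ 3) := by gcongr
      _ = C / M ^ 2 := by field_simp
  have h1 : M ^ 2 - M ^ 3 * t ≤ C := by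
    have h := (abs_le.1 hMt).1
    have h' := mul_le_mul_of_nonneg_left h (sq_nonneg M)
    have e : M ^ 2 * -(C / M ^ 2) = -C := by field_simp
    nlinarith
  have h2 : -(M * s * t) ≤ -s + |s| / 8 := by
    have e : -(M * s * t) = -s - s * (M * t - 1) := by ring
    have hb : |s * (M * t - 1)| ≤ |s| / 8 := by
      rw [abs_mul, div_eq_mul_inv]
      gcongr
      refine hMt.trans ?_
      rw [div_le_iff₀ (by positivity)]
      linarith
    rw [e]
    linarith [(abs_le.1 hb).1]
  have h3 : |s| ≤ s + 2 * |L| := by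
    rcases abs_cases s with h | h <;> linarith
  have h4 : y ^ 2 / 40 ≤ (M ^ 3 + M * s) * (1 / M * (y / M) ^ 2 / 20) := by
    calc y ^ 2 / 40 = M ^ 3 / 2 * (1 / M * (y / M) ^ 2 / 20) := by field_simp; ring
      _ ≤ _ := by gcongr
  have h5 := mul_le_mul_of_nonneg_left hlow ((by positivity : 0 ≤ M ^ 3 / 2).trans hmul)
  nlinarith

lemma norm_hermKer_sub_airyKer_le {P : ℝ} (hP : 0 ≤ P) (hP2 : P ≤ 2) (L : ℝ) :
    ∃ K > 0, ∃ M₀ ≥ 4, ∀ M ≥ M₀, ∀ s ≥ -L, ∀ y : ℝ, |y| ≤ M * π / 2 →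
    ‖hermKer P M s y - airyKer s y‖ ≤
      K / M ^ 2 * Real.exp (-3 / 4 * s) * Real.exp (-(1 / 80) * y ^ 2) := by
  obtain ⟨δ, hδ, C, hC, hT⟩ := exists_taylor_bounds P
  obtain ⟨K, hK, M₀, hM₀, hX⟩ := norm_exp_phase_le L
  set K' := K + Real.exp (1 / 3 + |L| / 8) with hK'
  set c5 : ℝ := (5 : ℕ).factorial * Real.exp 21 with hc5
  set c1 : ℝ := (1 : ℕ).factorial * 8 ^ 1 * Real.exp (1 / 8 + |L| / 4) with hc1
  have hK'0 : 0 < K' := by positivity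
  refine ⟨K' * (3 * C + 5 / δ ^ 4) * c5 * c1, by positivity, M₀, hM₀, fun M hM s hs y hy => ?_⟩
  have hM4 : 4 ≤ M := hM₀.trans hM
  have hM0 : 0 < M := by linarith
  set E := Real.exp (-y ^ 2 / 40) * Real.exp (-7 / 8 * s) with hE
  have hE0 : 0 < E := by positivity
  set θ := vline y / M with hθ
  have hζ : vline y = M * θ := by
    have hMc : (M : ℂ) ≠ 0 := by exact_mod_cast hM0.ne'
    rw [hθ]; field_simp
  have hθn : ‖θ‖ ≤ (1 + |y|) / M := by
    rw [hθ, norm_div, Complex.norm_real, Real.norm_of_nonneg hM0.le]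
    gcongr
    exact norm_vline_le y
  set X : ℂ := M ^ 3 * θ - (M ^ 3 + M * s) * expTanh θ with hXdef
  set Y : ℂ := vline y ^ 3 / 3 - s * vline y with hYdef
  have hXb : ‖Complex.exp X‖ ≤ K' * E := by
    refine (hX M hM s hs y hy).trans ?_
    gcongr
    rw [hK']; linarith [Real.exp_pos (1 / 3 + |L| / 8)]
  have hYb : ‖Complex.exp Y‖ ≤ K' * E := by
    have h : ‖Complex.exp Y‖ = Real.exp (1 / 3 - y ^ 2 - s) := norm_airyKer s y
    rw [h]
    calc Real.exp (1 / 3 - y ^ 2 - s) ≤ Real.exp (1 / 3 + |L| / 8) * E := by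
          rw [hE, ← Real.exp_add, ← Real.exp_add]
          refine Real.exp_le_exp.2 ?_
          nlinarith [le_abs_self L, sq_nonneg y]
      _ ≤ K' * E := by gcongr; rw [hK']; linarith
  have hy1 : 1 ≤ 1 + |y| := by linarith [abs_nonneg y]
  have hs1 : 1 ≤ 1 + |s| := by linarith [abs_nonneg s]
  have key : ‖hermKer P M s y - airyKer s y‖ ≤
      K' * E * ((3 * C + 5 / δ ^ 4) / M ^ 2) * ((1 + |s|) * (1 + |y|) ^ 5) := by
    set A := Complex.exp (-P * logCosh θ) with hA
    have hker : hermKer P M s y - airyKer s y = A * Complex.exp X - Complex.exp Y := rfl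
    rw [hker]
    by_cases hn : ‖θ‖ ≤ δ
    · obtain ⟨hT1, hT2, hT3⟩ := hT θ hn
      have hA1 : ‖A - 1‖ ≤ C / M ^ 2 * ((1 + |s|) * (1 + |y|) ^ 5) := by
        calc ‖A - 1‖ ≤ C * ‖θ‖ ^ 2 := hT3
          _ ≤ C * ((1 + |y|) / M) ^ 2 := by gcongr
          _ = C / M ^ 2 * (1 * (1 + |y|) ^ 2) := by field_simp
          _ ≤ C / M ^ 2 * ((1 + |s|) * (1 + |y|) ^ 5) := by gcongr; norm_num
      have hXY : ‖X - Y‖ ≤ 2 * C / M ^ 2 * ((1 + |s|) * (1 + |y|) ^ 5) := by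
        have e : X - Y = -(M ^ 3 * (expTanh θ - θ + θ ^ 3 / 3)) - M * s * (expTanh θ - θ) := by
          rw [hXdef, hYdef, hζ]; ring
        have n1 : ‖-(M ^ 3 * (expTanh θ - θ + θ ^ 3 / 3) : ℂ)‖ ≤
            C / M ^ 2 * ((1 + |s|) * (1 + |y|) ^ 5) := by
          rw [norm_neg, norm_mul, norm_pow, Complex.norm_real, Real.norm_of_nonneg hM0.le]
          calc M ^ 3 * ‖expTanh θ - θ + θ ^ 3 / 3‖ ≤ M ^ 3 * (C * ((1 + |y|) / M) ^ 5) := by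
                gcongr
                exact hT2.trans (by gcongr)
            _ = C / M ^ 2 * (1 * (1 + |y|) ^ 5) := by field_simp
            _ ≤ _ := by gcongr
        have n2 : ‖(M * s * (expTanh θ - θ) : ℂ)‖ ≤ C / M ^ 2 * ((1 + |s|) * (1 + |y|) ^ 5) := by
          rw [norm_mul, norm_mul, Complex.norm_real, Complex.norm_real,
            Real.norm_of_nonneg hM0.le, Real.norm_eq_abs]
          calc M * |s| * ‖expTanh θ - θ‖ ≤ M * |s| * (C * ((1 + |y|) / M) ^ 3) := by
                gcongr
                exact hT1.trans (by gcongr)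
            _ = C / M ^ 2 * (|s| * (1 + |y|) ^ 3) := by field_simp
            _ ≤ _ := by
                gcongr
                · linarith
                · norm_num
        rw [e]
        refine (norm_sub_le _ _).trans ((add_le_add n1 n2).trans_eq ?_)
        ring
      have e2 : A * Complex.exp X - Complex.exp Y =
          (A - 1) * Complex.exp X + (Complex.exp X - Complex.exp Y) := by ring
      rw [e2]
      calc _ ≤ ‖A - 1‖ * ‖Complex.exp X‖ + ‖Complex.exp X - Complex.exp Y‖ := by
            refine (norm_add_le _ _).trans ?_
            rw [norm_mul]
        _ ≤ C / M ^ 2 * ((1 + |s|) * (1 + |y|) ^ 5) * (K' * E) +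
            K' * E * (2 * C / M ^ 2 * ((1 + |s|) * (1 + |y|) ^ 5)) := by
            gcongr
            exact (norm_exp_sub_exp_le hXb hYb).trans (by gcongr)
        _ = K' * E * ((3 * C) / M ^ 2) * ((1 + |s|) * (1 + |y|) ^ 5) := by ring
        _ ≤ _ := by
            gcongr
            linarith [(by positivity : 0 < 5 / δ ^ 4)]
    · have hfar : 1 ≤ ((1 + |y|) / (δ * M)) ^ 4 := by
        refine one_le_pow₀ ?_
        rw [one_le_div (by positivity)]
        have := (not_le.1 hn).le.trans hθn
        rwa [le_div_iff₀ hM0] at this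
      have hAb : ‖A‖ ≤ 4 * M ^ 2 := by
        have hre : θ.re = 1 / M := vline_div_re y M
        have h := norm_exp_logCosh_le hP hP2 (θ := θ) (by rw [hre]; positivity)
          (by rw [hre]; exact one_div_le_one_div_of_le (by norm_num) hM4)
        rw [hre] at h
        refine h.trans_eq ?_
        field_simp
      calc _ ≤ ‖A‖ * ‖Complex.exp X‖ + ‖Complex.exp Y‖ := by
            refine (norm_sub_le _ _).trans ?_
            rw [norm_mul]
        _ ≤ 4 * M ^ 2 * (K' * E) + M ^ 2 * (K' * E) := by
            gcongr
            exact hYb.trans (le_mul_of_one_le_left (by positivity) (by nlinarith))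
        _ = 5 * M ^ 2 * (K' * E) * 1 := by ring
        _ ≤ 5 * M ^ 2 * (K' * E) * ((1 + |y|) / (δ * M)) ^ 4 := by gcongr
        _ = K' * E * ((5 / δ ^ 4) / M ^ 2) * (1 * (1 + |y|) ^ 4) := by field_simp
        _ ≤ _ := by
            gcongr
            · linarith
            · norm_num
  refine key.trans ?_
  have b1 := one_add_abs_pow_le_exp 1 hs
  rw [pow_one] at b1
  have b2 := one_add_abs_pow_le 5 y
  calc _ ≤ K' * E * ((3 * C + 5 / δ ^ 4) / M ^ 2) *
        ((c1 * Real.exp (s / 8)) * (c5 * Real.exp (y ^ 2 / 80))) := by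
        gcongr
    _ = K' * (3 * C + 5 / δ ^ 4) * c5 * c1 / M ^ 2 * (Real.exp (-7 / 8 * s) * Real.exp (s / 8)) *
        (Real.exp (-y ^ 2 / 40) * Real.exp (y ^ 2 / 80)) := by rw [hE]; ring
    _ = _ := by
        rw [← Real.exp_add, ← Real.exp_add]
        congr 3 <;> ring_nf

lemma continuous_hermKer (P s : ℝ) {M : ℝ} (hM : 0 < M) : Continuous (hermKer P M s) := by
  have hv : Continuous fun y => vline y / (M : ℂ) := continuous_vline.div_const _
  have hlt : ∀ y, ‖Complex.exp (-2 * (vline y / M))‖ < 1 := by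
    intro y
    have hre := vline_div_re y M
    rw [Complex.norm_exp, Real.exp_lt_one_iff]
    have : (-2 * (vline y / M) : ℂ).re = -2 * (vline y / M).re := by simp
    rw [this, hre]
    have : 0 < 1 / M := by positivity
    linarith
  have hpos : ∀ y, 0 < (1 + Complex.exp (-2 * (vline y / M))).re := by
    intro y
    have h := (abs_le.1 (Complex.abs_re_le_norm (Complex.exp (-2 * (vline y / M))))).1
    rw [Complex.add_re, Complex.one_re]
    linarith [hlt y]
  have hq : Continuous fun y => Complex.exp (-2 * (vline y / M)) := by fun_prop
  have hlog : Continuous fun y => logCosh (vline y / M) := by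
    unfold logCosh
    refine (((continuous_const.add hq).div_const 2).clog fun y => Or.inl ?_).add hv
    have := hpos y
    simp only [Complex.div_ofNat_re]
    positivity
  have htanh : Continuous fun y => expTanh (vline y / M) := by
    unfold expTanh
    refine (continuous_const.sub hq).div (continuous_const.add hq) fun y h => ?_
    have := hpos y
    rw [h] at this
    simp at this
  unfold hermKer
  fun_prop

lemma norm_integral_hermKer_sub_le {P : ℝ} (hP : 0 ≤ P) (hP2 : P ≤ 2) (L : ℝ) :
    ∃ K > 0, ∃ M₀ ≥ 4, ∀ M ≥ M₀, ∀ s ≥ -L,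
    ‖(∫ y in (-(M * π / 2))..(M * π / 2), hermKer P M s y) - airyInt 0 s‖ ≤
      K / M ^ 2 * Real.exp (-3 / 4 * s) := by
  obtain ⟨K, hK, M₀, hM₀, hb⟩ := norm_hermKer_sub_airyKer_le hP hP2 L
  set G := ∫ y : ℝ, Real.exp (-(1 / 80) * y ^ 2) with hG
  have hG0 : 0 < G := by
    rw [hG, integral_gaussian]; positivity
  set c := Real.exp (1 / 3 + |L| / 4) with hc
  have hc2 : (0 : ℝ) < c * ((2 : ℕ).factorial * Real.exp 21) := by positivity
  refine ⟨(K + c * ((2 : ℕ).factorial * Real.exp 21)) * G, by positivity, M₀, hM₀,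
    fun M hM s hs => ?_⟩
  have hM4 : 4 ≤ M := hM₀.trans hM
  have hM0 : 0 < M := by linarith
  set B : ℝ := (K + c * ((2 : ℕ).factorial * Real.exp 21)) / M ^ 2 * Real.exp (-3 / 4 * s) with hB
  set S := Set.Ioc (-(M * π / 2)) (M * π / 2) with hS
  have hint : Integrable (airyKer s) := by
    have := integrable_pow_mul_airyKer 0 s
    simpa using this
  have hind : Integrable (S.indicator (hermKer P M s)) :=
    (((continuous_hermKer P s hM0).intervalIntegrable _ _).1).integrable_indicator
      measurableSet_Ioc
  have hle : -(M * π / 2) ≤ M * π / 2 := by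
    have : 0 < M * π / 2 := by positivity
    linarith
  have heq : (∫ y in (-(M * π / 2))..(M * π / 2), hermKer P M s y) - airyInt 0 s =
      ∫ y, (S.indicator (hermKer P M s) y - airyKer s y) := by
    rw [integral_sub hind hint, integral_indicator measurableSet_Ioc,
      intervalIntegral.integral_of_le hle, airyInt]
    simp
  rw [heq]
  have hfin : ∫ y : ℝ, B * Real.exp (-(1 / 80) * y ^ 2) =
      (K + c * ((2 : ℕ).factorial * Real.exp 21)) * G / M ^ 2 * Real.exp (-3 / 4 * s) := by
    rw [integral_const_mul, ← hG, hB]; ring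
  rw [← hfin]
  refine norm_integral_le_of_norm_le (integrable_gaussian_bound B) (ae_of_all _ fun y => ?_)
  by_cases hy : y ∈ S
  · rw [Set.indicator_of_mem hy]
    refine (hb M hM s hs y (abs_le.2 ⟨hy.1.le, hy.2⟩)).trans ?_
    rw [hB]
    gcongr
    linarith
  · rw [Set.indicator_of_notMem hy, zero_sub, norm_neg, norm_airyKer]
    have hyM : M ≤ |y| := by
      by_contra hlt
      rw [not_le] at hlt
      have := Real.pi_gt_three
      obtain ⟨h1, h2⟩ := abs_lt.1 hlt
      exact hy ⟨by nlinarith, by nlinarith⟩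
    have h1 : 1 ≤ (1 + |y|) ^ 2 / M ^ 2 := by
      rw [one_le_div (by positivity)]
      gcongr
      linarith
    have h2 : Real.exp (1 / 3 - y ^ 2 - s) ≤
        c * Real.exp (-3 / 4 * s) * Real.exp (-y ^ 2 / 40) := by
      rw [hc, ← Real.exp_add, ← Real.exp_add]
      refine Real.exp_le_exp.2 ?_
      nlinarith [le_abs_self L, sq_nonneg y]
    calc Real.exp (1 / 3 - y ^ 2 - s) = Real.exp (1 / 3 - y ^ 2 - s) * 1 := (mul_one _).symm
      _ ≤ c * Real.exp (-3 / 4 * s) * Real.exp (-y ^ 2 / 40) *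
          (((2 : ℕ).factorial * Real.exp 21 * Real.exp (y ^ 2 / 80)) / M ^ 2) := by
          refine mul_le_mul h2 (h1.trans ?_) zero_le_one (by positivity)
          gcongr
          exact one_add_abs_pow_le 2 y
      _ = (c * ((2 : ℕ).factorial * Real.exp 21)) / M ^ 2 * Real.exp (-3 / 4 * s) *
          (Real.exp (-y ^ 2 / 40) * Real.exp (y ^ 2 / 80)) := by ring
      _ = (c * ((2 : ℕ).factorial * Real.exp 21)) / M ^ 2 * Real.exp (-3 / 4 * s) *
          Real.exp (-(1 / 80) * y ^ 2) := by
          rw [← Real.exp_add]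
          congr 2
          ring
      _ ≤ B * Real.exp (-(1 / 80) * y ^ 2) := by
          rw [hB]
          gcongr
          linarith

lemma norm_exp_neg_two_mul_lt_one {θ : ℂ} (h : 0 < θ.re) : ‖Complex.exp (-2 * θ)‖ < 1 := by
  rw [Complex.norm_exp, Real.exp_lt_one_iff]
  have : (-2 * θ : ℂ).re = -2 * θ.re := by simp
  linarith

lemma one_add_exp_neg_two_mul_ne_zero {θ : ℂ} (h : 0 < θ.re) : 1 + Complex.exp (-2 * θ) ≠ 0 := by
  intro h0
  have h1 := norm_exp_neg_two_mul_lt_one h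
  rw [show Complex.exp (-2 * θ) = -1 by linear_combination h0] at h1
  simp at h1

lemma lagGen_neg_exp {P X : ℝ} {m : ℕ} {θ : ℂ} (h : 0 < θ.re) :
    Complex.exp (-(X / 2 : ℝ)) * ((-Complex.exp (-2 * θ))⁻¹ ^ m *
        lagGen P X (-Complex.exp (-2 * θ))) =
      (-1) ^ m * Real.exp (-P * Real.log 2) * (Complex.exp (-P * logCosh θ) *
        Complex.exp ((2 * m + P) * θ - (X / 2 : ℝ) * expTanh θ)) := by
  have hq := one_add_exp_neg_two_mul_ne_zero h
  have hpow : (-Complex.exp (-2 * θ))⁻¹ ^ m = (-1) ^ m * Complex.exp (2 * m * θ) := by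
    rw [← neg_one_mul, mul_inv, mul_pow, ← Complex.exp_neg, ← Complex.exp_nat_mul]
    congr 2
    · norm_num
    · ring
  have hlog : Complex.log (1 - -Complex.exp (-2 * θ)) = Real.log 2 + (logCosh θ - θ) := by
    rw [logCosh, add_sub_cancel_right, ← Complex.log_ofReal_mul two_pos (div_ne_zero hq two_ne_zero)]
    congr 1
    push_cast
    ring
  have hfrac : -(X / 2 : ℝ) + -X * -Complex.exp (-2 * θ) / (1 - -Complex.exp (-2 * θ)) =
      -((X / 2 : ℝ) * expTanh θ) := by
    rw [expTanh, sub_neg_eq_add]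
    generalize Complex.exp (-2 * θ) = q at hq
    push_cast
    field_simp
    ring
  rw [lagGen, hpow, hlog, Complex.ofReal_exp]
  calc _ = (-1) ^ m * (Complex.exp (2 * m * θ) * Complex.exp (-P * (Real.log 2 + (logCosh θ - θ))) *
        (Complex.exp (-(X / 2 : ℝ)) *
        Complex.exp (-X * -Complex.exp (-2 * θ) / (1 - -Complex.exp (-2 * θ))))) := by ring
    _ = _ := by
        rw [← Complex.exp_add (-_) (_ / _), hfrac, ← Complex.exp_add, ← Complex.exp_add,
          ← Complex.exp_add, mul_assoc ((-1 : ℂ) ^ m), ← Complex.exp_add]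
        congr 2
        push_cast
        ring

lemma exp_mul_lagCoeff {P M s X : ℝ} {m : ℕ} (hM : 0 < M) (hM3 : M ^ 3 = 2 * m + P)
    (hX : X / 2 = M ^ 3 + M * s) :
    Complex.exp (-(X / 2 : ℝ)) * lagCoeff P X (Real.exp (-2 / M)) m =
      (-1) ^ m * Real.exp (-P * Real.log 2) * (2 / M : ℝ) *
        ∫ y in (-(M * π / 2))..(M * π / 2), hermKer P M s y := by
  have hsub := intervalIntegral.smul_integral_comp_sub_mul
    (a := -(M * π / 2)) (b := M * π / 2) (fun t : ℝ => (circleMap 0 (Real.exp (-2 / M)) t)⁻¹ ^ m *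
      lagGen P X (circleMap 0 (Real.exp (-2 / M)) t)) (2 / M) π
  rw [show π - 2 / M * (M * π / 2) = 0 by field_simp; ring,
    show π - 2 / M * -(M * π / 2) = 2 * π by field_simp; ring] at hsub
  rw [lagCoeff, ← hsub, Complex.real_smul, mul_left_comm, mul_right_comm, mul_comm _ ((2 / M : ℝ) : ℂ)]
  congr 1
  rw [← intervalIntegral.integral_const_mul, ← intervalIntegral.integral_const_mul]
  refine intervalIntegral.integral_congr fun y _ => ?_
  have hc : circleMap 0 (Real.exp (-2 / M)) (π - 2 / M * y) = -Complex.exp (-2 * (vline y / M)) := by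
    rw [circleMap, zero_add, Complex.ofReal_exp, ← Complex.exp_add,
      ← neg_one_mul (Complex.exp (-2 * _)), ← Complex.exp_pi_mul_I, ← Complex.exp_add]
    congr 1
    rw [vline]
    push_cast
    ring
  simp only [hc]
  rw [lagGen_neg_exp (by rw [vline_div_re]; positivity), hermKer]
  have hM3' : (2 * m + P : ℂ) = M ^ 3 := by exact_mod_cast hM3.symm
  rw [hX, hM3']
  push_cast
  rfl

lemma exp_mul_eq_integral_hermKer {P M s x c H : ℝ} {m : ℕ} (hM : 0 < M)
    (hM3 : M ^ 3 = 2 * m + P) (hx : x ^ 2 / 2 = M ^ 3 + M * s)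
    (hH : (2 * π * H : ℂ) = c * ((-4) ^ m * m.factorial) *
      lagCoeff P (x ^ 2) (Real.exp (-2 / M)) m) :
    Real.exp (-x ^ 2 / 2) * H =
      c * (4 ^ m * m.factorial) * Real.exp (-P * Real.log 2) * (2 / M) *
        ((2 * π)⁻¹ * (∫ y in (-(M * π / 2))..(M * π / 2), hermKer P M s y).re) := by
  have h2 := exp_mul_lagCoeff hM hM3 hx
  have hp : ((-1 : ℂ) ^ m) * (-1) ^ m = 1 := by rw [← mul_pow]; norm_num
  have h4 : ((-4 : ℂ) ^ m) = (-1) ^ m * 4 ^ m := by rw [← mul_pow]; norm_num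
  have h3 : ((2 * π * (Real.exp (-x ^ 2 / 2) * H) : ℝ) : ℂ) =
      ((c * (4 ^ m * m.factorial) * Real.exp (-P * Real.log 2) * (2 / M) : ℝ) : ℂ) *
        ∫ y in (-(M * π / 2))..(M * π / 2), hermKer P M s y := by
    rw [neg_div, ← Complex.ofReal_neg, ← Complex.ofReal_exp] at *
    rw [h4] at hH
    generalize Real.exp (-P * Real.log 2) = q at *
    generalize (∫ y in (-(M * π / 2))..(M * π / 2), hermKer P M s y) = I at *
    generalize Real.exp (-(x ^ 2 / 2)) = e at *
    push_cast at h2 ⊢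
    linear_combination e * hH + c * (-1) ^ m * 4 ^ m * m.factorial * h2 +
      c * 4 ^ m * m.factorial * q * (2 / M) * I * hp
  have h5 := congrArg Complex.re h3
  rw [Complex.ofReal_re, Complex.re_ofReal_mul] at h5
  have := Real.pi_pos
  rw [eq_comm, ← mul_assoc, mul_comm _ (2 * π)⁻¹, mul_assoc, ← h5]
  field_simp

lemma abs_sub_one_le_of_pow {K : ℝ} (hK : 0 ≤ K) (n : ℕ) : |K - 1| ≤ |K ^ (n + 1) - 1| := by
  rw [← geom_sum_mul K (n + 1), abs_mul]
  refine le_mul_of_one_le_left (abs_nonneg _) ((le_abs_self _).trans' ?_)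
  rw [Finset.sum_range_succ']
  simp only [pow_zero, le_add_iff_nonneg_left]
  positivity

lemma tauN_pow_six (N : ℕ) : tauN N ^ 6 = 1 / (8 * N) := by
  have h2 : (((2 : ℝ) ^ (-(1 : ℝ) / 2)) ^ 6) = 1 / 8 := by
    rw [← Real.rpow_natCast, ← Real.rpow_mul (by norm_num),
      show (-(1 : ℝ) / 2 * (6 : ℕ)) = ((-3 : ℤ) : ℝ) by norm_num, Real.rpow_intCast]
    norm_num
  have hN : ((N : ℝ) ^ (-(1 : ℝ) / 6)) ^ 6 = (N : ℝ)⁻¹ := by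
    rw [← Real.rpow_natCast, ← Real.rpow_mul (Nat.cast_nonneg N),
      show (-(1 : ℝ) / 6 * (6 : ℕ)) = ((-1 : ℤ) : ℝ) by norm_num, Real.rpow_intCast]
    norm_num
  rw [tauN, mul_pow, h2, hN, ← one_div, one_div_mul_one_div]

lemma tauN_pos {N : ℕ} (hN : 1 ≤ N) : 0 < tauN N := by
  have : (0 : ℝ) < N := by exact_mod_cast hN
  rw [tauN]; positivity

lemma hNorm_pos (n : ℕ) : 0 < hNorm n := by
  rw [hNorm]; positivity

lemma hNorm_rpow_sq (n : ℕ) : (hNorm n ^ (-(1 : ℝ) / 2)) ^ 2 = 1 / hNorm n := by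
  rw [← Real.rpow_natCast, ← Real.rpow_mul (hNorm_pos n).le,
    show (-(1 : ℝ) / 2 * (2 : ℕ)) = ((-1 : ℤ) : ℝ) by norm_num, Real.rpow_intCast]
  simp

lemma hNorm_pow_six (n : ℕ) : hNorm n ^ 6 = π ^ 3 * (2 ^ n) ^ 6 * (n.factorial : ℝ) ^ 6 := by
  rw [hNorm, mul_pow, mul_pow, show √π ^ 6 = (√π ^ 2) ^ 3 by ring, Real.sq_sqrt Real.pi_pos.le]

lemma rpow_quarter_pow_four {y : ℝ} (hy : 0 ≤ y) : (y ^ ((1 : ℝ) / 4)) ^ 4 = y := by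
  rw [← Real.rpow_natCast, ← Real.rpow_mul hy]
  norm_num

lemma wallis_pow_three (m : ℕ) : (2 / π * Real.Wallis.W m) ^ 3 =
    8 * (2 ^ m) ^ 12 * (m.factorial : ℝ) ^ 12 /
      (π ^ 3 * ((2 * m).factorial : ℝ) ^ 6 * (2 * m + 1) ^ 3) := by
  rw [Real.Wallis.W_eq_factorial_ratio, show (2 : ℝ) ^ (4 * m) = (2 ^ m) ^ 4 by
    rw [← pow_mul, mul_comm]]
  field_simp
  norm_num

lemma wallis_bounds (m : ℕ) : 1 - 1 / (2 * m + 2 : ℝ) ≤ 2 / π * Real.Wallis.W m ∧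
    2 / π * Real.Wallis.W m ≤ 1 := by
  have hπ := Real.pi_pos
  constructor
  · calc 1 - 1 / (2 * m + 2 : ℝ) = 2 / π * ((2 * m + 1) / (2 * m + 2) * (π / 2)) := by
          field_simp; ring
      _ ≤ _ := by gcongr; exact Real.Wallis.le_W m
  · calc 2 / π * Real.Wallis.W m ≤ 2 / π * (π / 2) := by gcongr; exact Real.Wallis.W_le m
      _ = 1 := by field_simp

lemma wallis_pow_three_bounds {m : ℕ} {n : ℝ} (hn : 1 ≤ n) (hnm : n ≤ 2 * m + 2) :
    1 - 3 / n ≤ (2 / π * Real.Wallis.W m) ^ 3 ∧ (2 / π * Real.Wallis.W m) ^ 3 ≤ 1 := by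
  obtain ⟨h1, h2⟩ := wallis_bounds m
  have hn0 : 0 < n := by linarith
  have h3 : 1 / (2 * m + 2 : ℝ) ≤ 1 / n := one_div_le_one_div_of_le hn0 hnm
  have h4 : 1 / n ≤ 1 := (div_le_one hn0).2 hn
  have h0 : 0 ≤ 1 - 1 / n := by linarith
  have h5 : 1 - 1 / n ≤ 2 / π * Real.Wallis.W m := by linarith
  refine ⟨?_, pow_le_one₀ (h0.trans h5) h2⟩
  refine le_trans ?_ (pow_le_pow_left₀ h0 h5 3)
  have := one_add_mul_le_pow (a := -(1 / n)) (by linarith) 3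
  calc 1 - 3 / n = 1 + (3 : ℕ) * -(1 / n) := by push_cast; ring
    _ ≤ _ := this
    _ = _ := by ring

lemma abs_even_constant_sub_one_le {N m : ℕ} (hN : N = 2 * m) (hN1 : 1 ≤ N) {M : ℝ} (hM : 0 < M)
    (hM3 : M ^ 3 = N + 1 / 2) :
    |(2 * N : ℝ) ^ ((1 : ℝ) / 4) * tauN N * hNorm N ^ (-(1 : ℝ) / 2) *
      (4 ^ m * m.factorial) * Real.exp (-(1 / 2) * Real.log 2) * (2 / M) - 1| ≤ 5 / N := by
  have hτ := tauN_pos hN1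
  have hh := hNorm_pos N
  have hN1' : (1 : ℝ) ≤ N := by exact_mod_cast hN1
  refine (abs_sub_one_le_of_pow (by positivity) 11).trans ?_
  have he : Real.exp (-(1 / 2) * Real.log 2) ^ 2 = 1 / 2 := by
    rw [← Real.exp_nat_mul, show ((2 : ℕ) : ℝ) * (-(1 / 2) * Real.log 2) = -Real.log 2 by
      push_cast; ring, Real.exp_neg, Real.exp_log two_pos, one_div]
  have hR : (N : ℝ) = 2 * m := by exact_mod_cast hN
  have h12 : ((2 * N : ℝ) ^ ((1 : ℝ) / 4) * tauN N * hNorm N ^ (-(1 : ℝ) / 2) *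
      (4 ^ m * m.factorial) * Real.exp (-(1 / 2) * Real.log 2) * (2 / M)) ^ 12 =
      (2 / π * Real.Wallis.W m) ^ 3 * (N * (N + 1) ^ 3 / (N + 1 / 2) ^ 4) := by
    calc _ = (((2 * N : ℝ) ^ ((1 : ℝ) / 4)) ^ 4) ^ 3 * (tauN N ^ 6) ^ 2 *
          ((hNorm N ^ (-(1 : ℝ) / 2)) ^ 2) ^ 6 * (4 ^ m * m.factorial) ^ 12 *
          (Real.exp (-(1 / 2) * Real.log 2) ^ 2) ^ 6 * (2 ^ 12 / (M ^ 3) ^ 4) := by ring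
      _ = _ := by
        rw [rpow_quarter_pow_four (by positivity), tauN_pow_six, hNorm_rpow_sq, he, hM3,
          div_pow 1 (hNorm N), hNorm_pow_six, wallis_pow_three, hN,
          show (2 : ℝ) ^ (2 * m) = (2 ^ m) ^ 2 by rw [← pow_mul, mul_comm],
          show (4 : ℝ) ^ m = (2 ^ m) ^ 2 by rw [← pow_mul, mul_comm, pow_mul]; norm_num, ← hN, ← hR]
        have hf : ((N.factorial : ℕ) : ℝ) ≠ 0 := by positivity
        have hmf : ((m.factorial : ℕ) : ℝ) ≠ 0 := by positivity
        have h2 : ((2 : ℝ) ^ m) ≠ 0 := by positivity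
        generalize (2 : ℝ) ^ m = T at *
        field_simp
        norm_num
  rw [h12]
  obtain ⟨w1, w2⟩ := wallis_pow_three_bounds (m := m) hN1' (by linarith)
  set w := (2 / π * Real.Wallis.W m) ^ 3
  have hw0 : 0 ≤ w := by
    have := Real.Wallis.W_pos m
    positivity
  have r1 : 1 ≤ (N * (N + 1) ^ 3 / (N + 1 / 2) ^ 4 : ℝ) := by
    rw [one_le_div (by positivity)]
    nlinarith [pow_pos (zero_lt_one.trans_le hN1') 3, pow_pos (zero_lt_one.trans_le hN1') 2]
  have r2 : (N * (N + 1) ^ 3 / (N + 1 / 2) ^ 4 : ℝ) ≤ 1 + 1 / N := by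
    rw [div_le_iff₀ (by positivity), one_add_div (by positivity), div_mul_eq_mul_div,
      le_div_iff₀ (by positivity)]
    have h0 : (0 : ℝ) ≤ N := by positivity
    nlinarith [pow_nonneg h0 4, pow_nonneg h0 3, pow_nonneg h0 2]
  set R := (N * (N + 1) ^ 3 / (N + 1 / 2) ^ 4 : ℝ)
  have e3 : (3 : ℝ) / N = 3 * (1 / N) := by ring
  have e5 : (5 : ℝ) / N = 5 * (1 / N) := by ring
  have hp : (0 : ℝ) < 1 / N := by positivity
  rw [abs_le]
  constructor <;> nlinarith

lemma abs_odd_constant_sub_one_le {N m : ℕ} (hN : N = 2 * m + 1) {M : ℝ} (hM : 0 < M)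
    (hM3 : M ^ 3 = N + 1 / 2) :
    |(2 * N : ℝ) ^ ((1 : ℝ) / 4) * tauN N * hNorm N ^ (-(1 : ℝ) / 2) *
      (2 * √(2 * N) * (4 ^ m * m.factorial)) * Real.exp (-(3 / 2) * Real.log 2) * (2 / M) - 1| ≤
      5 / N := by
  have hN1 : 1 ≤ N := by omega
  have hτ := tauN_pos hN1
  have hh := hNorm_pos N
  have hN1' : (1 : ℝ) ≤ N := by exact_mod_cast hN1
  refine (abs_sub_one_le_of_pow (by positivity) 11).trans ?_
  have he : Real.exp (-(3 / 2) * Real.log 2) ^ 2 = 1 / 8 := by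
    rw [← Real.exp_nat_mul, show ((2 : ℕ) : ℝ) * (-(3 / 2) * Real.log 2) =
      -((3 : ℕ) * Real.log 2) by push_cast; ring, Real.exp_neg, Real.exp_nat_mul,
      Real.exp_log two_pos]
    norm_num
  have hR : (N : ℝ) = 2 * m + 1 := by exact_mod_cast hN
  have h12 : ((2 * N : ℝ) ^ ((1 : ℝ) / 4) * tauN N * hNorm N ^ (-(1 : ℝ) / 2) *
      (2 * √(2 * N) * (4 ^ m * m.factorial)) * Real.exp (-(3 / 2) * Real.log 2) * (2 / M)) ^ 12 =
      (2 / π * Real.Wallis.W m) ^ 3 * (N / (N + 1 / 2)) ^ 4 := by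
    calc _ = (((2 * N : ℝ) ^ ((1 : ℝ) / 4)) ^ 4) ^ 3 * (tauN N ^ 6) ^ 2 *
          ((hNorm N ^ (-(1 : ℝ) / 2)) ^ 2) ^ 6 * (2 ^ 12 * (√(2 * N) ^ 2) ^ 6 *
          (4 ^ m * m.factorial) ^ 12) *
          (Real.exp (-(3 / 2) * Real.log 2) ^ 2) ^ 6 * (2 ^ 12 / (M ^ 3) ^ 4) := by ring
      _ = _ := by
        rw [rpow_quarter_pow_four (by positivity), tauN_pow_six, hNorm_rpow_sq, he, hM3,
          Real.sq_sqrt (by positivity),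
          div_pow 1 (hNorm N), hNorm_pow_six, wallis_pow_three, ← hR,
          show (N.factorial : ℝ) = N * (2 * m).factorial by
            rw [hN, Nat.factorial_succ]; push_cast; ring,
          show (2 : ℝ) ^ N = 2 * (2 ^ m) ^ 2 by rw [hN, pow_succ, mul_comm 2 m, pow_mul, mul_comm],
          show (4 : ℝ) ^ m = (2 ^ m) ^ 2 by rw [← pow_mul, mul_comm, pow_mul]; norm_num]
        have hf : (((2 * m).factorial : ℕ) : ℝ) ≠ 0 := by positivity
        have hmf : ((m.factorial : ℕ) : ℝ) ≠ 0 := by positivity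
        have h2 : ((2 : ℝ) ^ m) ≠ 0 := by positivity
        generalize (2 : ℝ) ^ m = T at *
        field_simp
        norm_num
  rw [h12]
  obtain ⟨w1, w2⟩ := wallis_pow_three_bounds (m := m) hN1' (by linarith)
  set w := (2 / π * Real.Wallis.W m) ^ 3
  have r0 : (0 : ℝ) ≤ N / (N + 1 / 2) := by positivity
  have r1 : (N / (N + 1 / 2) : ℝ) ≤ 1 := by
    rw [div_le_one (by positivity)]; linarith
  have r2 : 1 - 2 / N ≤ (N / (N + 1 / 2) : ℝ) ^ 4 := by
    have h := one_add_mul_le_pow (a := (N / (N + 1 / 2) : ℝ) - 1) (by linarith) 4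
    rw [add_sub_cancel] at h
    refine le_trans ?_ h
    have h1 : (N / (N + 1 / 2) : ℝ) = 1 - 1 / 2 / (N + 1 / 2) := by field_simp; ring
    have h2 : (1 / 2 / (N + 1 / 2) : ℝ) ≤ 1 / 2 / N := by gcongr; linarith
    have h3 : (2 / N : ℝ) = 4 * (1 / 2 / N) := by ring
    rw [h1, h3]
    push_cast
    linarith
  have r3 : (N / (N + 1 / 2) : ℝ) ^ 4 ≤ 1 := pow_le_one₀ r0 r1
  set R := (N / (N + 1 / 2) : ℝ) ^ 4
  have e2 : (2 : ℝ) / N = 2 * (1 / N) := by ring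
  have e3 : (3 : ℝ) / N = 3 * (1 / N) := by ring
  have e5 : (5 : ℝ) / N = 5 * (1 / N) := by ring
  have hp : (0 : ℝ) < 1 / N := by positivity
  have hR0 : 0 ≤ R := by positivity
  rw [abs_le]
  constructor <;> nlinarith [mul_nonneg (sub_nonneg.2 w2) (sub_nonneg.2 r3)]

/-- The scaled Hermite function is, up to a factor close to one, the integral of `hermKer`. -/
lemma scaled_osc_eq {N : ℕ} (hN : 1 ≤ N) {M : ℝ} (hM : 0 < M) (hM3 : M ^ 3 = N + 1 / 2)
    {x s : ℝ} (hx : x ^ 2 / 2 = M ^ 3 + M * s) :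
    ∃ P : ℝ, (P = 1 / 2 ∨ P = 3 / 2) ∧ ∃ R : ℝ, |R - 1| ≤ 5 / N + 6 * |x / √(2 * N) - 1| ∧
      (2 * N : ℝ) ^ ((1 : ℝ) / 4) * tauN N * osc N x =
        R * ((2 * π)⁻¹ * (∫ y in (-(M * π / 2))..(M * π / 2), hermKer P M s y).re) := by
  have hr : Real.exp (-2 / M) < 1 :=
    Real.exp_lt_one_iff.2 (div_neg_of_neg_of_pos (by norm_num) hM)
  have hNpos : (1 : ℝ) ≤ N := by exact_mod_cast hN
  obtain ⟨m, hm | hm⟩ := N.even_or_odd'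
  · have hR : (N : ℝ) = 2 * m := by exact_mod_cast hm
    refine ⟨1 / 2, Or.inl rfl, _, ((abs_even_constant_sub_one_le hm hN hM hM3).trans
      (le_add_of_nonneg_right (by positivity))), ?_⟩
    have h := exp_mul_eq_integral_hermKer (P := 1 / 2) (c := 1) (m := m)
      (H := physHermite (2 * m) x) hM (by rw [hM3, hR]) hx
      (by rw [Complex.ofReal_one, one_mul]
          exact (physHermite_eq_lagCoeff (Real.exp_pos _) hr x m).1)
    rw [osc, mul_assoc (hNorm N ^ _), hm, h]
    ring
  · have hR : (N : ℝ) = 2 * m + 1 := by exact_mod_cast hm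
    have hK := abs_odd_constant_sub_one_le hm hM hM3
    set K := (2 * N : ℝ) ^ ((1 : ℝ) / 4) * tauN N * hNorm N ^ (-(1 : ℝ) / 2) *
      (2 * √(2 * N) * (4 ^ m * m.factorial)) * Real.exp (-(3 / 2) * Real.log 2) * (2 / M) with hKdef
    refine ⟨3 / 2, Or.inr rfl, K * (x / √(2 * N)), ?_, ?_⟩
    · have h5 : (5 : ℝ) / N ≤ 5 := div_le_self (by norm_num) hNpos
      have hKb : |K| ≤ 6 := by
        have := abs_sub_abs_le_abs_sub K 1
        rw [abs_one] at this
        linarith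
      calc |K * (x / √(2 * N)) - 1| = |(K - 1) + K * (x / √(2 * N) - 1)| := by congr 1; ring
        _ ≤ |K - 1| + |K| * |x / √(2 * N) - 1| := by
            rw [← abs_mul]; exact abs_add_le _ _
        _ ≤ _ := by gcongr
    · have h := exp_mul_eq_integral_hermKer (P := 3 / 2) (c := 2 * x) (m := m)
        (H := physHermite (2 * m + 1) x) hM
        (by rw [hM3, hR]; ring) hx (by
          have := (physHermite_eq_lagCoeff (Real.exp_pos _) hr x m).2
          rw [show (1 / 2 + 1 : ℝ) = 3 / 2 by norm_num] at this
          push_cast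
          exact this)
      have hs : √(2 * N : ℝ) ≠ 0 := by positivity
      rw [osc, mul_assoc (hNorm N ^ _), show physHermite N x = physHermite (2 * m + 1) x by rw [hm],
        h, hKdef]
      field_simp

/-- The Hermite function in the soft-edge scaling. -/
noncomputable def scaledOsc (N : ℕ) (s : ℝ) : ℝ :=
  (2 * N : ℝ) ^ ((1 : ℝ) / 4) * tauN N * osc N (√(2 * N + 1) + tauN N * s)

/-- The derivative of `scaledOsc`. -/
noncomputable def scaledOscDeriv (N : ℕ) (s : ℝ) : ℝ :=
  (2 * N : ℝ) ^ ((1 : ℝ) / 4) * tauN N ^ 2 * deriv (osc N) (√(2 * N + 1) + tauN N * s)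

section Scales

variable {N : ℕ}

lemma rpow_neg_third_pow_three (N : ℕ) : ((N : ℝ) ^ (-(1 : ℝ) / 3)) ^ 3 = 1 / N := by
  rw [← Real.rpow_natCast, ← Real.rpow_mul (Nat.cast_nonneg N),
    show (-(1 : ℝ) / 3 * (3 : ℕ)) = ((-1 : ℤ) : ℝ) by norm_num, Real.rpow_intCast]
  simp

lemma rpow_neg_third_sq (N : ℕ) : ((N : ℝ) ^ (-(1 : ℝ) / 3)) ^ 2 = (N : ℝ) ^ (-(2 : ℝ) / 3) := by
  rw [← Real.rpow_natCast, ← Real.rpow_mul (Nat.cast_nonneg N)]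
  norm_num

lemma rpow_neg_third_pos (hN : 1 ≤ N) : 0 < (N : ℝ) ^ (-(1 : ℝ) / 3) := by
  have : (0 : ℝ) < N := by exact_mod_cast hN
  positivity

lemma rpow_neg_third_le_one (hN : 1 ≤ N) : (N : ℝ) ^ (-(1 : ℝ) / 3) ≤ 1 :=
  Real.rpow_le_one_of_one_le_of_nonpos (by exact_mod_cast hN) (by norm_num)

lemma one_div_le_rpow_neg_third_sq (hN : 1 ≤ N) : 1 / (N : ℝ) ≤ ((N : ℝ) ^ (-(1 : ℝ) / 3)) ^ 2 := by
  rw [← rpow_neg_third_pow_three]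
  exact pow_le_pow_of_le_one (rpow_neg_third_pos hN).le (rpow_neg_third_le_one hN) (by norm_num)

lemma tauN_sq (hN : 1 ≤ N) : tauN N ^ 2 = (N : ℝ) ^ (-(1 : ℝ) / 3) / 2 := by
  have hν := rpow_neg_third_pos hN
  refine (pow_left_inj₀ (by positivity) (by positivity) (three_ne_zero)).1 ?_
  rw [← pow_mul, tauN_pow_six, div_pow, rpow_neg_third_pow_three, div_div]
  norm_num [mul_comm]

lemma one_div_le_rpow_neg_third {M : ℝ} (hN : 1 ≤ N) (hM : 0 < M) (hM3 : M ^ 3 = N + 1 / 2) :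
    1 / M ≤ (N : ℝ) ^ (-(1 : ℝ) / 3) := by
  have hν := rpow_neg_third_pos hN
  refine (pow_le_pow_iff_left₀ (by positivity) hν.le three_ne_zero).1 ?_
  have : (0 : ℝ) < N := by exact_mod_cast hN
  rw [rpow_neg_third_pow_three, div_pow, hM3, one_pow]
  gcongr
  linarith

/-- The quadratic change of variable relating `scaledOsc` to `hermKer`. -/
lemma exists_shifted_variable {M : ℝ} (hN : 1 ≤ N) (hM : 0 < M) (hM3 : M ^ 3 = N + 1 / 2) (s : ℝ) :
    ∃ κ β : ℝ, 1 ≤ κ ∧ κ ≤ 1 + ((N : ℝ) ^ (-(1 : ℝ) / 3)) ^ 2 / 2 ∧ 0 ≤ β ∧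
      β ≤ ((N : ℝ) ^ (-(1 : ℝ) / 3)) ^ 2 / 4 ∧
      (√(2 * N + 1) + tauN N * s) ^ 2 / 2 = M ^ 3 + M * (κ * s + β * s ^ 2) := by
  have hν := rpow_neg_third_pos hN
  have hν2 := one_div_le_rpow_neg_third_sq hN
  have hνM := one_div_le_rpow_neg_third hN hM hM3
  have hτ := tauN_pos hN
  have hτ2 := tauN_sq hN
  have hN0 : (0 : ℝ) < N := by exact_mod_cast hN
  have hu : √(2 * N + 1 : ℝ) ^ 2 = 2 * N + 1 := Real.sq_sqrt (by positivity)
  set ν := (N : ℝ) ^ (-(1 : ℝ) / 3)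
  set u := √(2 * N + 1 : ℝ)
  have hu0 : 0 ≤ u := Real.sqrt_nonneg _
  have hκ6 : (u * tauN N / M) ^ 6 = 1 + 1 / (2 * N) := by
    calc (u * tauN N / M) ^ 6 = (u ^ 2) ^ 3 * tauN N ^ 6 / (M ^ 3) ^ 2 := by ring
      _ = _ := by
        rw [hu, tauN_pow_six, hM3]
        field_simp
        ring
  have h1 : 1 ≤ u * tauN N / M := by
    refine (pow_le_pow_iff_left₀ zero_le_one (by positivity) (by norm_num : (6 : ℕ) ≠ 0)).1 ?_
    rw [hκ6, one_pow]
    linarith [(by positivity : (0 : ℝ) ≤ 1 / (2 * N))]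
  refine ⟨u * tauN N / M, tauN N ^ 2 / (2 * M), h1, ?_, by positivity, ?_, ?_⟩
  · refine (le_self_pow₀ h1 (by norm_num : (6 : ℕ) ≠ 0)).trans (hκ6.trans_le ?_)
    rw [show (1 : ℝ) / (2 * N) = 1 / N / 2 by field_simp]
    linarith
  · calc tauN N ^ 2 / (2 * M) = ν / 4 * (1 / M) := by rw [hτ2]; field_simp; norm_num
      _ ≤ ν / 4 * ν := by gcongr
      _ = ν ^ 2 / 4 := by ring
  · rw [hM3, add_sq, hu]
    field_simp
    ring

lemma abs_div_sqrt_sub_one_le (hN : 1 ≤ N) (s : ℝ) :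
    |(√(2 * N + 1) + tauN N * s) / √(2 * N) - 1| ≤
      ((N : ℝ) ^ (-(1 : ℝ) / 3)) ^ 2 * (1 + |s|) := by
  have hν := rpow_neg_third_pos hN
  have hν2 := one_div_le_rpow_neg_third_sq hN
  have hν3 := rpow_neg_third_pow_three N
  have hτ := tauN_pos hN
  have hN0 : (0 : ℝ) < N := by exact_mod_cast hN
  have hτ2 := tauN_sq hN
  set ν := (N : ℝ) ^ (-(1 : ℝ) / 3)
  have h1 : |√(2 * N + 1) / √(2 * N) - 1| ≤ ν ^ 2 := by
    refine (abs_sub_one_le_of_pow (by positivity) 1).trans ?_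
    rw [div_pow, Real.sq_sqrt (by positivity), Real.sq_sqrt (by positivity)]
    rw [show (2 * N + 1 : ℝ) / (2 * N) - 1 = 1 / N / 2 by field_simp; ring, abs_of_pos (by positivity)]
    linarith [(by positivity : (0 : ℝ) < 1 / N)]
  have h2 : tauN N / √(2 * N) ≤ ν ^ 2 := by
    refine (pow_le_pow_iff_left₀ (by positivity) (by positivity) two_ne_zero).1 ?_
    rw [div_pow, Real.sq_sqrt (by positivity), hτ2]
    calc ν / 2 / (2 * N) = ν / 4 * (1 / N) := by field_simp; norm_num
      _ = ν ^ 4 / 4 := by rw [← hν3]; ring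
      _ ≤ (ν ^ 2) ^ 2 := by linarith [pow_pos hν 4, pow_mul ν 2 2]
  calc |(√(2 * N + 1) + tauN N * s) / √(2 * N) - 1|
      = |(√(2 * N + 1) / √(2 * N) - 1) + tauN N / √(2 * N) * s| := by congr 1; ring
    _ ≤ |√(2 * N + 1) / √(2 * N) - 1| + tauN N / √(2 * N) * |s| := by
        refine (abs_add_le _ _).trans_eq ?_
        rw [abs_mul, abs_of_pos (by positivity : 0 < tauN N / √(2 * N))]
    _ ≤ ν ^ 2 + ν ^ 2 * |s| := by gcongr
    _ = _ := by ring

lemma DeltaN_bounds (hN : 1 ≤ N) : 0 ≤ DeltaN N ∧ DeltaN N ≤ 2 * (N : ℝ) ^ (-(1 : ℝ) / 3) := by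
  have hν := rpow_neg_third_pos hN
  have hν3 := rpow_neg_third_pow_three N
  have hτ := tauN_pos hN
  have hN1 : (1 : ℝ) ≤ N := by exact_mod_cast hN
  have hτ2 := tauN_sq hN
  set ν := (N : ℝ) ^ (-(1 : ℝ) / 3)
  have hu : √(2 * N + 1 : ℝ) ^ 2 = 2 * N + 1 := Real.sq_sqrt (by positivity)
  have hv : √(2 * N - 1 : ℝ) ^ 2 = 2 * N - 1 := Real.sq_sqrt (by linarith)
  have hu0 : 0 < √(2 * N + 1 : ℝ) := by positivity
  have hv0 : 0 ≤ √(2 * N - 1 : ℝ) := Real.sqrt_nonneg _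
  have huv : √(2 * N - 1 : ℝ) ≤ √(2 * N + 1) := Real.sqrt_le_sqrt (by linarith)
  rw [DeltaN]
  refine ⟨div_nonneg (by linarith) hτ.le, ?_⟩
  have h1 : 1 ≤ √(2 * N + 1) * tauN N * ν := by
    refine (pow_le_pow_iff_left₀ zero_le_one (by positivity) two_ne_zero).1 ?_
    rw [mul_pow, mul_pow, hu, hτ2]
    have : ν ^ 3 * N = 1 := by rw [hν3]; field_simp
    nlinarith [pow_pos hν 3]
  rw [div_le_iff₀ hτ]
  have h2 : (√(2 * N + 1 : ℝ) - √(2 * N - 1)) * √(2 * N + 1) ≤ 2 := by nlinarith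
  have h3 : (√(2 * N + 1 : ℝ) - √(2 * N - 1)) * 1 ≤
      (√(2 * N + 1) - √(2 * N - 1)) * (√(2 * N + 1) * tauN N * ν) := by
    gcongr
  have h4 : 0 ≤ tauN N * ν := by positivity
  nlinarith

end Scales

lemma hasDerivAt_scaledOsc (N : ℕ) (s : ℝ) :
    HasDerivAt (scaledOsc N) (scaledOscDeriv N s) s := by
  have h1 : HasDerivAt (fun s => √(2 * N + 1) + tauN N * s) (tauN N) s := by
    simpa using ((hasDerivAt_id s).const_mul (tauN N)).const_add (√(2 * N + 1))
  have h2 := (differentiable_osc N (√(2 * N + 1) + tauN N * s)).hasDerivAt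
  have h3 := (HasDerivAt.comp s h2 h1).const_mul ((2 * N : ℝ) ^ ((1 : ℝ) / 4) * tauN N)
  convert! h3 using 1
  rw [scaledOscDeriv]; ring

/-- The coefficient in the differential equation satisfied by `scaledOsc`. -/
noncomputable def scaledPotential (N : ℕ) (s : ℝ) : ℝ :=
  2 * √(2 * N + 1) * tauN N ^ 3 * s + tauN N ^ 4 * s ^ 2

lemma hasDerivAt_scaledOscDeriv (N : ℕ) (s : ℝ) :
    HasDerivAt (scaledOscDeriv N) (scaledPotential N s * scaledOsc N s) s := by
  have h1 : HasDerivAt (fun s => √(2 * N + 1) + tauN N * s) (tauN N) s := by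
    simpa using ((hasDerivAt_id s).const_mul (tauN N)).const_add (√(2 * N + 1))
  have h2 := hasDerivAt_deriv_osc N (√(2 * N + 1) + tauN N * s)
  have h3 := (HasDerivAt.comp s h2 h1).const_mul ((2 * N : ℝ) ^ ((1 : ℝ) / 4) * tauN N ^ 2)
  convert! h3 using 1
  have hu : √(2 * N + 1 : ℝ) ^ 2 = 2 * N + 1 := Real.sq_sqrt (by positivity)
  rw [scaledOsc, scaledPotential, add_sq, hu]; ring

lemma abs_scaledPotential_sub_le {N : ℕ} (hN : 1 ≤ N) (s : ℝ) :
    |scaledPotential N s - s| ≤ ((N : ℝ) ^ (-(1 : ℝ) / 3)) ^ 2 * (1 + |s|) ^ 2 := by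
  have hν := rpow_neg_third_pos hN
  have hν2 := one_div_le_rpow_neg_third_sq hN
  have hτ := tauN_pos hN
  have hN0 : (0 : ℝ) < N := by exact_mod_cast hN
  have hτ2 := tauN_sq hN
  set ν := (N : ℝ) ^ (-(1 : ℝ) / 3)
  have hu : √(2 * N + 1 : ℝ) ^ 2 = 2 * N + 1 := Real.sq_sqrt (by positivity)
  have h1 : |2 * √(2 * N + 1) * tauN N ^ 3 - 1| ≤ ν ^ 2 := by
    refine (abs_sub_one_le_of_pow (by positivity) 1).trans ?_
    have : (2 * √(2 * N + 1) * tauN N ^ 3) ^ (1 + 1) - 1 = 1 / N / 2 := by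
      calc (2 * √(2 * N + 1) * tauN N ^ 3) ^ (1 + 1) - 1 =
          4 * √(2 * N + 1) ^ 2 * tauN N ^ 6 - 1 := by ring
        _ = _ := by rw [hu, tauN_pow_six]; field_simp; ring
    rw [this, abs_of_pos (by positivity)]
    linarith [(by positivity : (0 : ℝ) < 1 / N)]
  have h2 : tauN N ^ 4 = ν ^ 2 / 4 := by
    rw [show tauN N ^ 4 = (tauN N ^ 2) ^ 2 by ring, hτ2]; ring
  calc |scaledPotential N s - s| =
      |(2 * √(2 * N + 1) * tauN N ^ 3 - 1) * s + ν ^ 2 / 4 * s ^ 2| := by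
        rw [scaledPotential, h2]; congr 1; ring
    _ ≤ ν ^ 2 * |s| + ν ^ 2 / 4 * |s| ^ 2 := by
        refine (abs_add_le _ _).trans ?_
        rw [abs_mul, abs_mul, abs_pow, abs_of_pos (by positivity : 0 < ν ^ 2 / 4)]
        gcongr
    _ ≤ _ := by nlinarith [sq_nonneg ν, abs_nonneg s, mul_nonneg (sq_nonneg ν) (abs_nonneg s),
                  mul_nonneg (sq_nonneg ν) (sq_nonneg |s|)]

lemma abs_taylor_one_le {f f' f'' : ℝ → ℝ} {a b B : ℝ} (hf : ∀ t, HasDerivAt f (f' t) t)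
    (hf' : ∀ t, HasDerivAt f' (f'' t) t) (hB : ∀ t ∈ Set.uIcc a b, |f'' t| ≤ B) :
    |f b - f a - (b - a) * f' a| ≤ B * (b - a) ^ 2 := by
  have hB0 : 0 ≤ B := (abs_nonneg _).trans (hB a Set.left_mem_uIcc)
  have h1 : ∀ t ∈ Set.uIcc a b, ‖f' t - f' a‖ ≤ B * |b - a| := by
    intro t ht
    have h := (convex_uIcc a b).norm_image_sub_le_of_norm_hasDerivWithin_le
      (fun x _ => (hf' x).hasDerivWithinAt) hB Set.left_mem_uIcc ht
    refine h.trans ?_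
    gcongr
    exact Set.abs_sub_left_of_mem_uIcc ht
  have h2 := (convex_uIcc a b).norm_image_sub_le_of_norm_hasDerivWithin_le
    (f := fun t => f t - t * f' a)
    (fun x _ => ((hf x).sub ((hasDerivAt_id x).mul_const (f' a))).hasDerivWithinAt)
    (fun t ht => by simpa using h1 t ht) Set.left_mem_uIcc Set.right_mem_uIcc
  rw [Real.norm_eq_abs, Real.norm_eq_abs, mul_assoc, abs_mul_abs_self] at h2
  calc |f b - f a - (b - a) * f' a| = |f b - b * f' a - (f a - a * f' a)| := by congr 1; ring
    _ ≤ _ := h2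
    _ = _ := by ring

lemma exists_norm_integral_hermKer_sub_le (L : ℝ) :
    ∃ K > 0, ∃ M₀ ≥ 4, ∀ P : ℝ, (P = 1 / 2 ∨ P = 3 / 2) → ∀ M ≥ M₀, ∀ s ≥ -L,
    |(2 * π)⁻¹ * (∫ y in (-(M * π / 2))..(M * π / 2), hermKer P M s y).re - Ai s| ≤
      K / M ^ 2 * Real.exp (-3 / 4 * s) := by
  obtain ⟨K₁, hK₁, M₁, hM₁, h₁⟩ :=
    norm_integral_hermKer_sub_le (P := 1 / 2) (by norm_num) (by norm_num) L
  obtain ⟨K₂, hK₂, M₂, hM₂, h₂⟩ :=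
    norm_integral_hermKer_sub_le (P := 3 / 2) (by norm_num) (by norm_num) L
  have hre : ∀ {K M s : ℝ} {I : ℂ}, K ≤ K₁ + K₂ →
      ‖I - airyInt 0 s‖ ≤ K / M ^ 2 * Real.exp (-3 / 4 * s) →
      |(2 * π)⁻¹ * I.re - Ai s| ≤ (K₁ + K₂) / M ^ 2 * Real.exp (-3 / 4 * s) := by
    intro K M s I hK h
    have hπ : (2 * π)⁻¹ ≤ 1 := inv_le_one_of_one_le₀ (by linarith [Real.pi_gt_three])
    rw [Ai_eq, ← mul_sub, ← Complex.sub_re, abs_mul, abs_of_pos (by positivity : 0 < (2 * π)⁻¹)]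
    calc (2 * π)⁻¹ * |(I - airyInt 0 s).re| ≤ 1 * ‖I - airyInt 0 s‖ := by
          gcongr
          exact Complex.abs_re_le_norm _
      _ ≤ K / M ^ 2 * Real.exp (-3 / 4 * s) := by rwa [one_mul]
      _ ≤ _ := by gcongr
  refine ⟨K₁ + K₂, by positivity, max M₁ M₂, hM₁.trans (le_max_left _ _), ?_⟩
  rintro P (rfl | rfl) M hM s hs
  · exact hre (by linarith) (h₁ M ((le_max_left _ _).trans hM) s hs)
  · exact hre (by linarith) (h₂ M ((le_max_right _ _).trans hM) s hs)

lemma abs_Ai_sub_Ai_le : ∃ A > 0, ∀ c s t : ℝ, c ≤ s → c ≤ t →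
    |Ai t - Ai s| ≤ A * Real.exp (-c) * |t - s| := by
  obtain ⟨A, hA, h⟩ := abs_deriv_Ai_le
  refine ⟨A, hA, fun c s t hs ht => ?_⟩
  refine (convex_Ici c).norm_image_sub_le_of_norm_hasDerivWithin_le
    (fun x _ => (hasDerivAt_Ai x).hasDerivWithinAt) (fun x hx => (h x).trans ?_) hs ht
  gcongr
  exact hx

set_option maxHeartbeats 1000000 in
lemma abs_scaledOsc_sub_Ai_le {L : ℝ} (hL : 0 ≤ L) : ∃ C > 0, ∃ N₀ ≥ 1, ∀ N : ℕ, N₀ ≤ N →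
    ∀ s ≥ -L, |scaledOsc N s - Ai s| ≤
      C * ((N : ℝ) ^ (-(1 : ℝ) / 3)) ^ 2 * Real.exp (-5 / 8 * s) := by
  obtain ⟨K, hK, M₀, hM₀, hI⟩ := exists_norm_integral_hermKer_sub_le (2 * L)
  obtain ⟨A, hA, hAi⟩ := abs_Ai_le
  obtain ⟨A', hA', hAi'⟩ := abs_Ai_sub_Ai_le
  set c : ℝ := (2 : ℕ).factorial * 8 ^ 2 * Real.exp (1 / 8 + |L| / 4) with hc
  set D := (K + A + A') * Real.exp (2 * L) with hD
  refine ⟨24 * D * c, by positivity, max 1 ⌈M₀ ^ 3⌉₊, le_max_left _ _, fun N hN s hs => ?_⟩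
  have hN1 : 1 ≤ N := (le_max_left _ _).trans hN
  have hNM : M₀ ^ 3 ≤ N := Nat.ceil_le.1 ((le_max_right _ _).trans hN)
  obtain ⟨M, hM, hM3⟩ : ∃ M : ℝ, 0 < M ∧ M ^ 3 = N + 1 / 2 := by
    refine ⟨((N : ℝ) + 1 / 2) ^ ((1 : ℝ) / 3), by positivity, ?_⟩
    rw [← Real.rpow_natCast, ← Real.rpow_mul (by positivity)]
    norm_num
  have hMM : M₀ ≤ M :=
    (pow_le_pow_iff_left₀ (by linarith) hM.le three_ne_zero).1 (by rw [hM3]; linarith)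
  have hν := rpow_neg_third_pos hN1
  have hν1 := rpow_neg_third_le_one hN1
  have hνN := one_div_le_rpow_neg_third_sq hN1
  have hνM := one_div_le_rpow_neg_third hN1 hM hM3
  have hρ := abs_div_sqrt_sub_one_le hN1 s
  obtain ⟨κ, β, hκ1, hκ2, hβ1, hβ2, hx⟩ := exists_shifted_variable hN1 hM hM3 s
  obtain ⟨P, hP, R, hR, hf⟩ := scaled_osc_eq hN1 hM hM3 hx
  set ν := (N : ℝ) ^ (-(1 : ℝ) / 3)
  set t := κ * s + β * s ^ 2
  have hν2 : ν ^ 2 ≤ 1 := pow_le_one₀ hν.le hν1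
  have hts : s - L ≤ t := by
    have : 0 ≤ β * s ^ 2 := by positivity
    rcases le_total 0 s with h | h <;> nlinarith
  have htd : |t - s| ≤ ν ^ 2 * (1 + |s|) ^ 2 := by
    have e : t - s = (κ - 1) * s + β * s ^ 2 := by ring
    rw [e]
    calc _ ≤ (κ - 1) * |s| + β * |s| ^ 2 := by
          refine (abs_add_le _ _).trans_eq ?_
          rw [abs_mul, abs_mul, abs_pow, abs_of_nonneg hβ1, abs_of_nonneg (by linarith : 0 ≤ κ - 1)]
      _ ≤ ν ^ 2 / 2 * |s| + ν ^ 2 / 4 * |s| ^ 2 := by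
          gcongr
          linarith
      _ ≤ _ := by nlinarith [sq_nonneg ν, mul_nonneg (sq_nonneg ν) (abs_nonneg s),
                    mul_nonneg (sq_nonneg ν) (sq_nonneg |s|)]
  set G := Real.exp (-3 / 4 * s) with hG
  have hG0 : 0 < G := Real.exp_pos _
  have hexp : ∀ {y : ℝ}, y ≤ 2 * L - 3 / 4 * s → Real.exp y ≤ Real.exp (2 * L) * G := by
    intro y hy
    rw [hG, ← Real.exp_add]
    exact Real.exp_le_exp.2 (by linarith)
  set J := (2 * π)⁻¹ * (∫ y in (-(M * π / 2))..(M * π / 2), hermKer P M t y).re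
  have h1 : |J - Ai t| ≤ D * ν ^ 2 * G := by
    have h := hI P hP M hMM t (by linarith)
    have hM2 : 1 / M ^ 2 ≤ ν ^ 2 := by
      have := pow_le_pow_left₀ (by positivity) hνM 2
      rwa [div_pow, one_pow] at this
    calc |J - Ai t| ≤ K / M ^ 2 * Real.exp (-3 / 4 * t) := h
      _ = K * (1 / M ^ 2) * Real.exp (-3 / 4 * t) := by ring
      _ ≤ (K + A + A') * ν ^ 2 * (Real.exp (2 * L) * G) := by
          gcongr
          · linarith
          · exact hexp (by linarith)
      _ = _ := by rw [hD]; ring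
  have h2 : |Ai t| ≤ D * G := by
    calc |Ai t| ≤ A * Real.exp (-t) := hAi t
      _ ≤ (K + A + A') * (Real.exp (2 * L) * G) := by
          gcongr
          · linarith
          · exact hexp (by linarith)
      _ = _ := by rw [hD]; ring
  have h3 : |Ai t - Ai s| ≤ D * G * (ν ^ 2 * (1 + |s|) ^ 2) := by
    calc |Ai t - Ai s| ≤ A' * Real.exp (-(s - L)) * |t - s| := hAi' (s - L) s t (by linarith) hts
      _ ≤ (K + A + A') * (Real.exp (2 * L) * G) * (ν ^ 2 * (1 + |s|) ^ 2) := by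
          gcongr
          · linarith
          · exact hexp (by linarith)
      _ = _ := by rw [hD]; ring
  have hDpos : 0 < D := by positivity
  have hJ : |J| ≤ 2 * D * G := by
    have e : J = (J - Ai t) + Ai t := by ring
    rw [e]
    refine (abs_add_le _ _).trans ?_
    have : D * ν ^ 2 * G ≤ D * 1 * G := by gcongr
    linarith
  have hR' : |R - 1| ≤ 11 * ν ^ 2 * (1 + |s|) := by
    have h5 : (5 : ℝ) / N = 5 * (1 / N) := by ring
    have hs0 : 0 ≤ ν ^ 2 * |s| := by positivity
    rw [h5] at hR
    linarith
  have hs1 : 1 ≤ 1 + |s| := by linarith [abs_nonneg s]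
  have hfin : |scaledOsc N s - Ai s| ≤ 24 * D * ν ^ 2 * (G * (1 + |s|) ^ 2) := by
    have e : scaledOsc N s - Ai s = (R - 1) * J + (J - Ai t) + (Ai t - Ai s) := by
      rw [scaledOsc, hf]; ring
    rw [e]
    calc _ ≤ |R - 1| * |J| + |J - Ai t| + |Ai t - Ai s| := by
          refine (abs_add_le _ _).trans (add_le_add_left ((abs_add_le _ _).trans ?_) _)
          rw [abs_mul]
      _ ≤ 11 * ν ^ 2 * (1 + |s|) * (2 * D * G) + D * ν ^ 2 * G +
          D * G * (ν ^ 2 * (1 + |s|) ^ 2) := by gcongr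
      _ = D * ν ^ 2 * G * (22 * (1 + |s|) ^ 1 + 1 + (1 + |s|) ^ 2) := by ring
      _ ≤ D * ν ^ 2 * G * (22 * (1 + |s|) ^ 2 + (1 + |s|) ^ 2 + (1 + |s|) ^ 2) := by
          gcongr
          · norm_num
          · exact one_le_pow₀ hs1
      _ = _ := by ring
  refine hfin.trans ?_
  calc _ ≤ 24 * D * ν ^ 2 * (G * (c * Real.exp (s / 8))) := by
        gcongr
        exact one_add_abs_pow_le_exp 2 hs
    _ = 24 * D * c * ν ^ 2 * (G * Real.exp (s / 8)) := by ring
    _ = _ := by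
        rw [hG, ← Real.exp_add]
        congr 2
        ring

lemma scaledOsc_sub_Ai_bounds {L : ℝ} (hL : 0 ≤ L) : ∃ C > 0, ∃ N₀ ≥ 1, ∀ N : ℕ, N₀ ≤ N →
    ∀ s ≥ -L,
      |scaledOsc N s - Ai s| ≤ C * ((N : ℝ) ^ (-(1 : ℝ) / 3)) ^ 2 * Real.exp (-s / 2) ∧
      |scaledOscDeriv N s - deriv Ai s| ≤
        C * ((N : ℝ) ^ (-(1 : ℝ) / 3)) ^ 2 * Real.exp (-s / 2) := by
  obtain ⟨K, hK, N₀, hN₀, hE⟩ := abs_scaledOsc_sub_Ai_le hL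
  obtain ⟨A, hA, hAi⟩ := abs_Ai_le
  set c : ℝ := (2 : ℕ).factorial * 8 ^ 2 * Real.exp (1 / 8 + |L| / 4) with hc
  set B := (2 * K + A) * c * Real.exp L with hB
  have hB0 : 0 < B := by positivity
  have hKB : K * Real.exp L ≤ B := by
    have : 1 ≤ c := by
      have h := Real.one_le_exp (by positivity : 0 ≤ 1 / 8 + |L| / 4)
      rw [hc, Nat.factorial_two]
      push_cast
      linarith
    rw [hB]
    gcongr
    nlinarith
  refine ⟨3 * B, by positivity, N₀, hN₀, fun N hN => ?_⟩
  have hN1 : 1 ≤ N := hN₀.trans hN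
  have hν := rpow_neg_third_pos hN1
  have hν1 := rpow_neg_third_le_one hN1
  have hpot := abs_scaledPotential_sub_le hN1
  have hE := hE N hN
  set ν := (N : ℝ) ^ (-(1 : ℝ) / 3)
  have hν2 : ν ^ 2 ≤ 1 := pow_le_one₀ hν.le hν1
  have h0 : ∀ s ≥ -L, |scaledOsc N s - Ai s| ≤ B * ν ^ 2 * Real.exp (-s / 2) := by
    intro s hs
    calc |scaledOsc N s - Ai s| ≤ K * ν ^ 2 * Real.exp (-5 / 8 * s) := hE s hs
      _ ≤ K * ν ^ 2 * (Real.exp L * Real.exp (-s / 2)) := by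
          rw [← Real.exp_add]
          gcongr
          linarith
      _ = K * Real.exp L * ν ^ 2 * Real.exp (-s / 2) := by ring
      _ ≤ _ := by gcongr
  have h2 : ∀ s ≥ -L, |scaledPotential N s * scaledOsc N s - s * Ai s| ≤
      B * ν ^ 2 * Real.exp (-s / 2) := by
    intro s hs
    have hq := hpot s
    have hs0 := abs_nonneg s
    have hq2 : |scaledPotential N s| ≤ 2 * (1 + |s|) ^ 2 := by
      have h := abs_sub_abs_le_abs_sub (scaledPotential N s) s
      have : ν ^ 2 * (1 + |s|) ^ 2 ≤ 1 * (1 + |s|) ^ 2 := by gcongr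
      nlinarith
    have e : scaledPotential N s * scaledOsc N s - s * Ai s =
        scaledPotential N s * (scaledOsc N s - Ai s) + (scaledPotential N s - s) * Ai s := by ring
    rw [e]
    calc _ ≤ |scaledPotential N s| * |scaledOsc N s - Ai s| + |scaledPotential N s - s| * |Ai s| := by
          rw [← abs_mul, ← abs_mul]; exact abs_add_le _ _
      _ ≤ 2 * (1 + |s|) ^ 2 * (K * ν ^ 2 * Real.exp (-5 / 8 * s)) +
          ν ^ 2 * (1 + |s|) ^ 2 * (A * (Real.exp L * Real.exp (-5 / 8 * s))) := by
          gcongr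
          · exact hE s hs
          · refine (hAi s).trans ?_
            rw [← Real.exp_add]
            gcongr
            linarith
      _ ≤ 2 * (1 + |s|) ^ 2 * (K * ν ^ 2 * (Real.exp L * Real.exp (-5 / 8 * s))) +
          ν ^ 2 * (1 + |s|) ^ 2 * (A * (Real.exp L * Real.exp (-5 / 8 * s))) := by
          gcongr
          exact le_mul_of_one_le_left (Real.exp_pos _).le (Real.one_le_exp hL)
      _ = (2 * K + A) * Real.exp L * ν ^ 2 * Real.exp (-5 / 8 * s) * (1 + |s|) ^ 2 := by ring
      _ ≤ (2 * K + A) * Real.exp L * ν ^ 2 * Real.exp (-5 / 8 * s) * (c * Real.exp (s / 8)) := by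
          gcongr
          exact one_add_abs_pow_le_exp 2 hs
      _ = B * ν ^ 2 * (Real.exp (-5 / 8 * s) * Real.exp (s / 8)) := by rw [hB]; ring
      _ = _ := by
          rw [← Real.exp_add]
          congr 2
          ring
  intro s hs
  refine ⟨(h0 s hs).trans (by gcongr; linarith), ?_⟩
  have hmono : ∀ t ≥ s, B * ν ^ 2 * Real.exp (-t / 2) ≤ B * ν ^ 2 * Real.exp (-s / 2) := by
    intro t ht
    gcongr
  have hT := abs_taylor_one_le (f := fun t => scaledOsc N t - Ai t)
    (f' := fun t => scaledOscDeriv N t - deriv Ai t) (a := s) (b := s + 1)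
    (fun t => (hasDerivAt_scaledOsc N t).sub (hasDerivAt_Ai t))
    (fun t => (hasDerivAt_scaledOscDeriv N t).sub (hasDerivAt_deriv_Ai t))
    (B := B * ν ^ 2 * Real.exp (-s / 2)) (fun t ht => by
      rw [Set.uIcc_of_le (by linarith)] at ht
      exact (h2 t (by linarith [ht.1])).trans (hmono t ht.1))
  rw [add_sub_cancel_left, one_pow, mul_one, one_mul] at hT
  have ha := h0 s hs
  have hb := (h0 (s + 1) (by linarith)).trans (hmono (s + 1) (by linarith))
  rw [abs_le] at *
  constructor <;> linarith [hT.1, hT.2, ha.1, ha.2, hb.1, hb.2]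

lemma Ai_taylor_bounds {L κ : ℝ} (hκ : 0 ≤ κ) : ∃ C > 0, ∀ s d : ℝ, -L ≤ s → -L ≤ s + d → |d| ≤ κ →
    |Ai (s + d) - Ai s - d * deriv Ai s| ≤ C * d ^ 2 * Real.exp (-s / 2) ∧
    |deriv Ai (s + d) - deriv Ai s - d * (s * Ai s)| ≤ C * d ^ 2 * Real.exp (-s / 2) := by
  obtain ⟨A, hA, hAi⟩ := abs_Ai_le
  obtain ⟨A', hA', hAi'⟩ := abs_deriv_Ai_le
  set c : ℝ := (1 : ℕ).factorial * 8 ^ 1 * Real.exp (1 / 8 + |L| / 4) with hc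
  set B := (A + A') * c * Real.exp (|L| + κ) with hB
  have hbound : ∀ s d : ℝ, -L ≤ s → -L ≤ s + d → |d| ≤ κ → ∀ t ∈ Set.uIcc s (s + d),
      (A + A') * ((1 + |t|) * Real.exp (-t)) ≤ B * Real.exp (-s / 2) := by
    intro s d hs hsd hd t ht
    have htL : -L ≤ t := (le_min hs hsd).trans ht.1
    have hts : s - κ ≤ t := by
      refine le_trans (le_min ?_ ?_) ht.1 <;> linarith [(abs_le.1 hd).1]
    have h := one_add_abs_pow_le_exp 1 htL
    rw [pow_one] at h
    calc (A + A') * ((1 + |t|) * Real.exp (-t))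
        ≤ (A + A') * ((c * Real.exp (t / 8)) * Real.exp (-t)) := by gcongr
      _ = (A + A') * c * Real.exp (t / 8 + -t) := by rw [Real.exp_add]; ring
      _ ≤ (A + A') * c * Real.exp (|L| + κ + -s / 2) := by
          refine mul_le_mul_of_nonneg_left (Real.exp_le_exp.2 ?_) (by positivity)
          linarith [le_abs_self L, abs_nonneg L]
      _ = _ := by rw [Real.exp_add, hB]; ring
  refine ⟨B, by positivity, fun s d hs hsd hd => ⟨?_, ?_⟩⟩
  · have h := abs_taylor_one_le hasDerivAt_Ai hasDerivAt_deriv_Ai (a := s) (b := s + d)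
      (B := B * Real.exp (-s / 2)) (fun t ht => by
        refine le_trans ?_ (hbound s d hs hsd hd t ht)
        rw [abs_mul]
        calc |t| * |Ai t| ≤ |t| * (A * Real.exp (-t)) := by gcongr; exact hAi t
          _ = A * (|t| * Real.exp (-t)) := by ring
          _ ≤ _ := by gcongr <;> linarith)
    rw [add_sub_cancel_left] at h
    linarith
  · have h := abs_taylor_one_le (f'' := fun t => 1 * Ai t + t * deriv Ai t)
      hasDerivAt_deriv_Ai (fun t => (hasDerivAt_id t).mul (hasDerivAt_Ai t))
      (a := s) (b := s + d)
      (B := B * Real.exp (-s / 2)) (fun t ht => by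
        refine le_trans ?_ (hbound s d hs hsd hd t ht)
        calc |1 * Ai t + t * deriv Ai t| ≤ |Ai t| + |t| * |deriv Ai t| := by
              rw [one_mul, ← abs_mul]; exact abs_add_le _ _
          _ ≤ A * Real.exp (-t) + |t| * (A' * Real.exp (-t)) := by
              gcongr
              · exact hAi t
              · exact hAi' t
          _ ≤ _ := by
              have := Real.exp_pos (-t)
              have h1 : 0 ≤ A' * Real.exp (-t) := by positivity
              have h2 : 0 ≤ A * (|t| * Real.exp (-t)) := by positivity
              nlinarith)
    rw [add_sub_cancel_left] at h
    linarith

/-- Shifted Airy expansion: with `u_N = √(2N+1)` and a shift `k Δ_N` in the rescaled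
variable, `(2N)^{1/4} τ_N φ_N(u_N + τ_N(s + kΔ_N)) = Ai(s) + kΔ_N Ai'(s) + O(N^{-2/3} e^{-s/2})`,
and likewise for the derivative. -/
theorem shifted_airy_expansion (k sL : ℝ) :
    ∃ C > 0, ∃ N₀ : ℕ, ∀ N : ℕ, N₀ ≤ N → ∀ s : ℝ, sL ≤ s →
      |(2 * N : ℝ) ^ ((1 : ℝ) / 4) * tauN N *
          osc N (Real.sqrt (2 * N + 1) + tauN N * (s + k * DeltaN N)) -
          Ai s - k * DeltaN N * deriv Ai s| ≤
        C * (N : ℝ) ^ (-(2 : ℝ) / 3) * Real.exp (-s / 2) ∧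
      |(2 * N : ℝ) ^ ((1 : ℝ) / 4) * tauN N ^ 2 *
          deriv (osc N) (Real.sqrt (2 * N + 1) + tauN N * (s + k * DeltaN N)) -
          deriv Ai s - k * DeltaN N * deriv (deriv Ai) s| ≤
        C * (N : ℝ) ^ (-(2 : ℝ) / 3) * Real.exp (-s / 2) := by
  set L := |sL| + 2 * |k| with hL
  obtain ⟨C₁, hC₁, N₀, hN₀, hE⟩ := scaledOsc_sub_Ai_bounds (L := L) (by positivity)
  obtain ⟨C₂, hC₂, hT⟩ := Ai_taylor_bounds (L := L) (κ := 2 * |k|) (by positivity)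
  refine ⟨C₁ * Real.exp |k| + C₂ * (4 * k ^ 2), by positivity, N₀, fun N hN s hs => ?_⟩
  have hN1 : 1 ≤ N := hN₀.trans hN
  have hν := rpow_neg_third_pos hN1
  have hν1 := rpow_neg_third_le_one hN1
  obtain ⟨hΔ0, hΔ⟩ := DeltaN_bounds hN1
  rw [← rpow_neg_third_sq]
  set ν := (N : ℝ) ^ (-(1 : ℝ) / 3) with hνdef
  set d := k * DeltaN N with hd
  have hdν : |d| ≤ 2 * |k| * ν := by
    rw [hd, abs_mul, abs_of_nonneg hΔ0]
    nlinarith [abs_nonneg k]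
  have hdk : |d| ≤ 2 * |k| := hdν.trans (mul_le_of_le_one_right (by positivity) hν1)
  have hd2 : d ^ 2 ≤ 4 * k ^ 2 * ν ^ 2 := by
    rw [← sq_abs d, ← sq_abs k]
    calc |d| ^ 2 ≤ (2 * |k| * ν) ^ 2 := by gcongr
      _ = _ := by ring
  have hsL : -L ≤ s := by linarith [neg_abs_le sL, abs_nonneg k]
  have hsd : -L ≤ s + d := by linarith [neg_abs_le sL, (abs_le.1 hdk).1]
  obtain ⟨e1, e2⟩ := hE N hN (s + d) hsd
  obtain ⟨t1, t2⟩ := hT s d hsL hsd hdk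
  have hexp : C₁ * ν ^ 2 * Real.exp (-(s + d) / 2) ≤
      C₁ * Real.exp |k| * ν ^ 2 * Real.exp (-s / 2) := by
    calc C₁ * ν ^ 2 * Real.exp (-(s + d) / 2) ≤ C₁ * ν ^ 2 * Real.exp (|k| + -s / 2) := by
          gcongr
          linarith [(abs_le.1 hdk).1]
      _ = _ := by rw [Real.exp_add]; ring
  have hquad : C₂ * d ^ 2 * Real.exp (-s / 2) ≤
      C₂ * (4 * k ^ 2) * ν ^ 2 * Real.exp (-s / 2) := by
    rw [mul_assoc C₂ (4 * k ^ 2)]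
    gcongr
  have hsum : ∀ {a b c e f : ℝ}, |a - b| ≤ C₁ * ν ^ 2 * Real.exp (-(s + d) / 2) →
      |b - c - e * f| ≤ C₂ * d ^ 2 * Real.exp (-s / 2) →
      |a - c - e * f| ≤ (C₁ * Real.exp |k| + C₂ * (4 * k ^ 2)) * ν ^ 2 * Real.exp (-s / 2) := by
    intro a b c e f h1 h2
    calc |a - c - e * f| = |(a - b) + (b - c - e * f)| := by congr 1; ring
      _ ≤ |a - b| + |b - c - e * f| := abs_add_le _ _
      _ ≤ _ := by linarith
  refine ⟨hsum e1 t1, ?_⟩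
  rw [(hasDerivAt_deriv_Ai s).deriv]
  exact hsum e2 t2
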